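/- arXiv:0810.0821 — 2 statements merged into one kernel-verified Lean document; each statement's English description precedes it below -/
import Mathlib

section
/- Let R be a reduced noetherian complete local 𝔽_q-algebra with algebraically closed residue field, and let b ∈ GL_r(R((z))). Suppose there are integers h ≥ 1 and m such that for every prime ideal 𝔭 of R there exists y ∈ GL_r(K_𝔭((z))) for which the element c := y⁻¹·b_𝔭·σ(y) satisfies c·σ(c)·σ²(c)⋯σ^{h−1}(c) = z^m·1_r (i.e. the Newton polygon of b is constant on Spec R and basic, equal to (m/h, …, m/h)). Then there exist b_F ∈ GL_r(𝔽_q((z))) and f ∈ GL_r(R((z))) with f·b = b_F·σ(f); that is, the local shtuka (R((z))^r, b·σ) is quasi-isogenous to a constant local shtuka defined over 𝔽_q. -/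
noncomputable section

open scoped Classical

namespace HVpaper

variable {A : Type*} [CommRing A]

/-- Coefficientwise `q`-th power map on formal Laurent series (the map `σ` for `q ≠ 0`;
junk value `0` for `q = 0`). -/
def laurentFrob (q : ℕ) (x : LaurentSeries A) : LaurentSeries A :=
  if hq : q = 0 then 0 else x.map (ZeroHom.mk (fun a : A => a ^ q) (zero_pow hq))

/-- Entrywise `σ` on matrices of Laurent series. -/
def matFrob (q : ℕ) {n : Type*} (M : Matrix n n (LaurentSeries A)) :
    Matrix n n (LaurentSeries A) :=
  M.map (laurentFrob q)

/-- `x` lies in `z^n · A⟦z⟧`, i.e. all coefficients below `n` vanish. -/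
def InZPow (n : ℤ) (x : LaurentSeries A) : Prop :=
  ∀ m : ℤ, m < n → x.coeff m = 0

/-- `x` lies in the subring `A⟦z⟧` of `A((z))`. -/
def InPS (x : LaurentSeries A) : Prop :=
  ∀ m : ℤ, m < 0 → x.coeff m = 0

/-- `u` is a unit of the subring `A⟦z⟧` of `A((z))`. -/
def IsPSUnit (u : LaurentSeries A) : Prop :=
  InPS u ∧ ∃ v : LaurentSeries A, InPS v ∧ u * v = 1

/-- The element `z^n` of `A((z))`. -/
def zPow (n : ℤ) : LaurentSeries A :=
  HahnSeries.single n 1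

/-- The coefficientwise map on Laurent series induced by a ring homomorphism. -/
def lmap {B : Type*} [CommRing B] (f : A →+* B) (x : LaurentSeries A) : LaurentSeries B :=
  x.map f

variable {k : Type*} [Field k]

/-- Membership in the subgroup `I_n` of `GL_r(k⟦z⟧)`:  `g` and its inverse have entries in
`k⟦z⟧`, `g ≡ 1 mod z^n` on the diagonal, the entries above the diagonal lie in `z^n k⟦z⟧` and
those below the diagonal lie in `z^(n+1) k⟦z⟧`.  For `n = 0` this is the standard Iwahori
subgroup. -/
def InIwahori {r : ℕ} (n : ℕ) (g : Matrix (Fin r) (Fin r) (LaurentSeries k)) : Prop :=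
  (∀ i j, InPS (g i j)) ∧ IsUnit g ∧ (∀ i j, InPS (g⁻¹ i j)) ∧
  (∀ i : Fin r, InZPow (n : ℤ) (g i i - 1)) ∧
  (∀ i j : Fin r, i < j → InZPow (n : ℤ) (g i j)) ∧
  (∀ i j : Fin r, j < i → InZPow ((n : ℤ) + 1) (g i j))

/-- The sum of the `i` smallest (i.e. last `i`) entries of the nonincreasing tuple `μ`. -/
def lowSum {r : ℕ} (μ : Fin r → ℤ) (i : ℕ) : ℤ :=
  ∑ j : Fin r, if r ≤ (j : ℕ) + i then μ j else 0

/-- The matrix `M` over `A((z))` is bounded by the dominant cocharacter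
`μ = (μ 0 ≥ … ≥ μ (r-1))` of `GL_r`: for each `1 ≤ i ≤ r` every `i×i` minor of `M` lies in
`z^(μ_{r-i+1}+⋯+μ_r)·A⟦z⟧` and `det M = z^(μ_1+⋯+μ_r)` times a unit of `A⟦z⟧`. -/
def BoundedBy {r : ℕ} (μ : Fin r → ℤ) (M : Matrix (Fin r) (Fin r) (LaurentSeries A)) : Prop :=
  (∀ i : Fin r, ∀ ri ci : Fin ((i : ℕ) + 1) → Fin r,
    InZPow (lowSum μ ((i : ℕ) + 1)) ((M.submatrix ri ci).det)) ∧
  (∃ u : LaurentSeries A, IsPSUnit u ∧ M.det = zPow (∑ j, μ j) * u)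

/-- The product `c·σ(c)·σ²(c)⋯σ^(h−1)(c)` of a square matrix of Laurent series. -/
def sigmaPowProd (q : ℕ) {r : ℕ} (h : ℕ)
    (c : Matrix (Fin r) (Fin r) (LaurentSeries A)) :
    Matrix (Fin r) (Fin r) (LaurentSeries A) :=
  ((List.range h).map fun i => (matFrob q)^[i] c).prod

/-- For a prime `𝔭` of `R`, the canonical homomorphism from `R` to `K_𝔭`, an algebraic
closure of the fraction field of `R ⧸ 𝔭`. -/
def ptHom {R : Type*} [CommRing R] (𝔭 : PrimeSpectrum R) :
    R →+* AlgebraicClosure (FractionRing (R ⧸ 𝔭.asIdeal)) :=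
  ((algebraMap (FractionRing (R ⧸ 𝔭.asIdeal))
      (AlgebraicClosure (FractionRing (R ⧸ 𝔭.asIdeal)))).comp
    ((algebraMap (R ⧸ 𝔭.asIdeal) (FractionRing (R ⧸ 𝔭.asIdeal))).comp
      (Ideal.Quotient.mk 𝔭.asIdeal)))

/-! ### Twisted norms -/

section TwistedNorm

variable {S T : Type*} [Ring S] [Ring T]

/-- `c · s(c) ⋯ s^(n-1)(c)`. -/
def nm (s : S →+* S) (c : S) : ℕ → S
  | 0 => 1
  | n + 1 => nm s c n * s^[n] c

lemma nm_add (s : S →+* S) (c : S) (a b : ℕ) :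
    nm s c (a + b) = nm s c a * s^[a] (nm s c b) := by
  induction b with
  | zero => simp [nm, iterate_map_one]
  | succ b ih =>
    rw [← add_assoc, nm, ih, nm, iterate_map_mul, mul_assoc, Function.iterate_add_apply]

lemma nm_succ' (s : S →+* S) (c : S) (a : ℕ) : nm s c (a + 1) = c * s (nm s c a) := by
  rw [add_comm, nm_add]; simp [nm]

lemma nm_conj (s : S →+* S) {y y' : S} (hy : y' * y = 1) (hy' : y * y' = 1) (c : S) (n : ℕ) :
    nm s (y' * c * s y) n = y' * nm s c n * s^[n] y := by
  induction n with
  | zero => simp [nm, hy]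
  | succ n ih =>
    have h1 : s^[n] y * s^[n] y' = 1 := by
      rw [← iterate_map_mul, hy', iterate_map_one]
    rw [nm, ih, nm, iterate_map_mul, iterate_map_mul,
      ← Function.iterate_succ_apply]
    calc _ = y' * nm s c n * (s^[n] y * s^[n] y') * s^[n] c * s^[n.succ] y := by
          simp only [mul_assoc]
      _ = _ := by rw [h1]; simp only [mul_assoc, mul_one]

lemma nm_map (s : S →+* S) (t : T →+* T) (g : S →+* T) (hg : ∀ x, g (s x) = t (g x))
    (c : S) (n : ℕ) : g (nm s c n) = nm t (g c) n := by
  induction n with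
  | zero => simp [nm]
  | succ n ih =>
    have : g (s^[n] c) = t^[n] (g c) := by
      have := (Function.Semiconj.iterate_right (f := g) (ga := s) (gb := t) hg n) c
      simpa using this
    rw [nm, map_mul, ih, this, nm]

lemma nm_mul (s : S →+* S) (c : S) (a : ℕ) (t : S →+* S) (ht : ∀ x, t x = s^[a] x) (n : ℕ) :
    nm s c (a * n) = nm t (nm s c a) n := by
  induction n with
  | zero => simp [nm]
  | succ n ih =>
    have : ∀ x, s^[a * n] x = t^[n] x := by
      intro x
      rw [Function.iterate_mul]
      congr 1
      exact (funext ht).symm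
    rw [mul_add, mul_one, nm_add, ih, this, nm]

lemma nm_eq_prod (s : S →+* S) (c : S) (n : ℕ) :
    nm s c n = ((List.range n).map fun i => s^[i] c).prod := by
  induction n with
  | zero => simp [nm]
  | succ n ih => rw [nm, ih, List.range_succ]; simp

lemma isUnit_nm (s : S →+* S) {c : S} (hc : IsUnit c) (n : ℕ) : IsUnit (nm s c n) := by
  induction n with
  | zero => simp [nm]
  | succ n ih =>
    refine ih.mul ?_
    clear ih
    induction n with
    | zero => simpa
    | succ n ih => rw [Function.iterate_succ_apply']; exact ih.map s

end TwistedNorm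

/-! ### Functoriality of Laurent series -/

/-- `lmap` as a ring homomorphism. -/
def lmapHom {A B : Type*} [CommRing A] [CommRing B] (f : A →+* B) :
    LaurentSeries A →+* LaurentSeries B where
  toFun := lmap f
  map_one' := by
    ext n
    simp only [lmap, HahnSeries.map_coeff, HahnSeries.coeff_one]
    split_ifs <;> simp
  map_zero' := by ext; simp [lmap]
  map_add' x y := by ext; simp [lmap]
  map_mul' x y := HahnSeries.map_mul (f : A →ₙ+* B)

lemma lmapHom_coeff {A B : Type*} [CommRing A] [CommRing B] (f : A →+* B) (x : LaurentSeries A)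
    (n : ℤ) : (lmapHom f x).coeff n = f (x.coeff n) := rfl

lemma lmapHom_apply {A B : Type*} [CommRing A] [CommRing B] (f : A →+* B) (x : LaurentSeries A) :
    lmapHom f x = lmap f x := rfl

lemma lmapHom_zPow {A B : Type*} [CommRing A] [CommRing B] (f : A →+* B) (n : ℤ) :
    lmapHom f (zPow n) = zPow n := by
  ext k
  rw [lmapHom_coeff]
  simp only [zPow, HahnSeries.coeff_single]
  split_ifs <;> simp

lemma zPow_add {A : Type*} [CommRing A] (a b : ℤ) :
    (zPow (a + b) : LaurentSeries A) = zPow a * zPow b := by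
  simp [zPow, HahnSeries.single_mul_single]

lemma zPow_zero {A : Type*} [CommRing A] : (zPow 0 : LaurentSeries A) = 1 := rfl

/-- The ring endomorphism `σ` of `A((z))`. -/
def sg (p e : ℕ) (A : Type*) [CommRing A] [ExpChar A p] :
    LaurentSeries A →+* LaurentSeries A := lmapHom (iterateFrobenius A p e)

lemma sg_coeff (p e : ℕ) {A : Type*} [CommRing A] [ExpChar A p] (x : LaurentSeries A) (n : ℤ) :
    (sg p e A x).coeff n = x.coeff n ^ p ^ e := rfl

lemma laurentFrob_coeff {q : ℕ} (hq : q ≠ 0) {A : Type*} [CommRing A] (x : LaurentSeries A)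
    (n : ℤ) : (laurentFrob q x).coeff n = x.coeff n ^ q := by
  simp [laurentFrob, hq]

lemma laurentFrob_eq (p e : ℕ) [Fact p.Prime] {A : Type*} [CommRing A] [ExpChar A p]
    (x : LaurentSeries A) : laurentFrob (p ^ e) x = sg p e A x := by
  ext n
  rw [laurentFrob_coeff (pow_ne_zero _ (Fact.out : p.Prime).ne_zero), sg_coeff]

/-- `σ` on matrices as a ring endomorphism. -/
def msg (p e : ℕ) (A : Type*) [CommRing A] [ExpChar A p] (r : ℕ) :
    Matrix (Fin r) (Fin r) (LaurentSeries A) →+* Matrix (Fin r) (Fin r) (LaurentSeries A) :=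
  (sg p e A).mapMatrix

lemma matFrob_eq (p e : ℕ) [Fact p.Prime] {A : Type*} [CommRing A] [ExpChar A p] {r : ℕ}
    (M : Matrix (Fin r) (Fin r) (LaurentSeries A)) : matFrob (p ^ e) M = msg p e A r M := by
  exact Matrix.ext fun i j => laurentFrob_eq p e (M i j)

lemma sigmaPowProd_eq (p e : ℕ) [Fact p.Prime] {A : Type*} [CommRing A] [ExpChar A p] {r : ℕ}
    (h : ℕ) (M : Matrix (Fin r) (Fin r) (LaurentSeries A)) :
    sigmaPowProd (p ^ e) h M = nm (msg p e A r) M h := by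
  rw [nm_eq_prod, sigmaPowProd]
  have : (matFrob (p ^ e) : Matrix (Fin r) (Fin r) (LaurentSeries A) → _) = msg p e A r :=
    funext (matFrob_eq p e)
  rw [this]

lemma sg_lmap (p e : ℕ) {A B : Type*} [CommRing A] [CommRing B] [ExpChar A p] [ExpChar B p]
    (f : A →+* B) (x : LaurentSeries A) : lmapHom f (sg p e A x) = sg p e B (lmapHom f x) := by
  ext n
  simp only [lmapHom_coeff, sg_coeff, map_pow]

lemma sg_zPow (p e : ℕ) {A : Type*} [CommRing A] [ExpChar A p] (n : ℤ) :
    sg p e A (zPow n) = zPow n := lmapHom_zPow _ n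

lemma sg_iter_coeff (p e : ℕ) {A : Type*} [CommRing A] [ExpChar A p] (x : LaurentSeries A)
    (n : ℤ) (k : ℕ) : ((sg p e A)^[k] x).coeff n = x.coeff n ^ (p ^ e) ^ k := by
  induction k with
  | zero => simp
  | succ k ih => rw [Function.iterate_succ_apply', sg_coeff, ih, ← pow_mul, pow_succ (p ^ e)]

lemma msg_iter_apply (p e : ℕ) {A : Type*} [CommRing A] [ExpChar A p] {r : ℕ}
    (M : Matrix (Fin r) (Fin r) (LaurentSeries A)) (k : ℕ) (i j : Fin r) :
    ((msg p e A r)^[k] M) i j = (sg p e A)^[k] (M i j) := by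
  induction k with
  | zero => simp
  | succ k ih => rw [Function.iterate_succ_apply', Function.iterate_succ_apply', ← ih]; rfl

/-! ### The isoclinic semilinear algebra -/

section Division

open WithZero Multiplicative

variable {L : Type*} [Field L] {r : ℕ}

/-- A norm for which the semilinear map `F` is homogeneous. -/
def fnorm (v : Valuation L ℤᵐ⁰) (F : (Fin r → L) → (Fin r → L)) (n : ℕ) (m : ℤ)
    (x : Fin r → L) : ℤᵐ⁰ :=
  Finset.univ.sup fun i : Fin n × Fin r => v ((F^[i.1] x) i.2) ^ n * exp (m * (i.1 : ℕ))

lemma fnorm_le {v : Valuation L ℤᵐ⁰} {F : (Fin r → L) → (Fin r → L)} {n : ℕ} {m : ℤ}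
    {x : Fin r → L} {g : ℤᵐ⁰} :
    fnorm v F n m x ≤ g ↔
      ∀ i : ℕ, i < n → ∀ j, v ((F^[i] x) j) ^ n * exp (m * (i : ℕ)) ≤ g := by
  unfold fnorm
  rw [Finset.sup_le_iff]
  constructor
  · intro h i hi j
    exact h (⟨i, hi⟩, j) (Finset.mem_univ _)
  · intro h i _
    exact h i.1 i.1.2 i.2

lemma F_iter_add (F : (Fin r → L) → (Fin r → L)) (hadd : ∀ x y, F (x + y) = F x + F y)
    (i : ℕ) (x y) : F^[i] (x + y) = F^[i] x + F^[i] y := by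
  induction i with
  | zero => simp
  | succ i ih => simp only [Function.iterate_succ_apply', ih, hadd]

lemma F_iter_smul (s : L →+* L) (F : (Fin r → L) → (Fin r → L))
    (hsmul : ∀ (a : L) x, F (a • x) = s a • F x)
    (i : ℕ) (a : L) (x) : F^[i] (a • x) = s^[i] a • F^[i] x := by
  induction i with
  | zero => simp
  | succ i ih => simp only [Function.iterate_succ_apply', ih, hsmul]

lemma v_iter (s : L →+* L) (v : Valuation L ℤᵐ⁰) (hvs : ∀ x, v (s x) = v x)
    (i : ℕ) (a : L) : v (s^[i] a) = v a := by
  induction i with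
  | zero => simp
  | succ i ih => simp only [Function.iterate_succ_apply', ih, hvs]

lemma fnorm_add (v : Valuation L ℤᵐ⁰) (F : (Fin r → L) → (Fin r → L)) (n : ℕ) (hn : 0 < n) (m : ℤ)
    (hadd : ∀ x y, F (x + y) = F x + F y)
    (x y) : fnorm v F n m (x + y) ≤ max (fnorm v F n m x) (fnorm v F n m y) := by
  rw [fnorm_le]
  intro i hi j
  rw [F_iter_add F hadd, Pi.add_apply]
  rcases le_max_iff.1 (v.map_add (F^[i] x j) (F^[i] y j)) with h | h
  · exact le_max_of_le_left ((mul_le_mul_left (pow_le_pow_left₀ zero_le' h n) _).trans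
      (fnorm_le.1 le_rfl i hi j))
  · exact le_max_of_le_right ((mul_le_mul_left (pow_le_pow_left₀ zero_le' h n) _).trans
      (fnorm_le.1 le_rfl i hi j))

lemma fnorm_smul_le (s : L →+* L) (v : Valuation L ℤᵐ⁰) (hvs : ∀ x, v (s x) = v x)
    (F : (Fin r → L) → (Fin r → L)) (n : ℕ) (m : ℤ) (hsmul : ∀ (a : L) x, F (a • x) = s a • F x)
    (a : L) (x) : fnorm v F n m (a • x) ≤ v a ^ n * fnorm v F n m x := by
  rw [fnorm_le]
  intro i hi j
  rw [F_iter_smul s F hsmul, Pi.smul_apply, smul_eq_mul, map_mul, v_iter s v hvs, mul_pow, mul_assoc]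
  exact mul_le_mul_right (fnorm_le.1 le_rfl i hi j) _

lemma fnorm_smul (s : L →+* L) (v : Valuation L ℤᵐ⁰) (hvs : ∀ x, v (s x) = v x)
    (F : (Fin r → L) → (Fin r → L)) (n : ℕ) (m : ℤ) (hsmul : ∀ (a : L) x, F (a • x) = s a • F x)
    {a : L} (ha : a ≠ 0) (x) :
    fnorm v F n m (a • x) = v a ^ n * fnorm v F n m x := by
  apply le_antisymm (fnorm_smul_le s v hvs F n m hsmul a x)
  have h := fnorm_smul_le s v hvs F n m hsmul a⁻¹ (a • x)
  rw [smul_smul, inv_mul_cancel₀ ha, one_smul] at h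
  have h2 := mul_le_mul_right h (v a ^ n)
  rwa [← mul_assoc, ← mul_pow, ← map_mul, mul_inv_cancel₀ ha, map_one, one_pow, one_mul] at h2

lemma fnorm_eq_zero (v : Valuation L ℤᵐ⁰) (F : (Fin r → L) → (Fin r → L)) (n : ℕ) (hn : 0 < n)
    (m : ℤ)
    {x} (h : fnorm v F n m x = 0) : x = 0 := by
  funext j
  have := fnorm_le.1 h.le 0 hn j
  simpa [hn.ne'] using this

lemma fnorm_F_le (v : Valuation L ℤᵐ⁰) (F : (Fin r → L) → (Fin r → L)) (n : ℕ) (hn : 0 < n)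
    (m : ℤ) (z : L) (hz : v z = exp (-1)) (hF : ∀ x, F^[n] x = z ^ m • x)
    (x) : fnorm v F n m (F x) ≤ exp (-m) * fnorm v F n m x := by
  rw [fnorm_le]
  intro i hi j
  rw [← Function.iterate_succ_apply]
  rcases Nat.lt_or_ge (i + 1) n with h | h
  · have h2 := mul_le_mul_right (fnorm_le.1 (le_refl (fnorm v F n m x)) (i + 1) h j) (exp (-m))
    refine le_trans (le_of_eq ?_) h2
    rw [mul_left_comm, ← exp_add]
    congr 2
    push_cast
    ring
  · obtain rfl : n = i + 1 := by omega
    have h2 := mul_le_mul_right (fnorm_le.1 (le_refl (fnorm v F (i+1) m x)) 0 hn j) (exp (-m))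
    refine le_trans (le_of_eq ?_) h2
    rw [Nat.succ_eq_add_one, hF, Pi.smul_apply, smul_eq_mul, map_mul, mul_pow, map_zpow₀, hz,
      ← exp_zsmul, ← exp_nsmul, mul_left_comm, ← exp_add, mul_right_comm, ← exp_add, mul_comm]
    simp only [Function.iterate_zero, id]
    congr 2
    simp
    ring

lemma fnorm_F_iter (s : L →+* L) (v : Valuation L ℤᵐ⁰) (hvs : ∀ x, v (s x) = v x)
    (F : (Fin r → L) → (Fin r → L)) (n : ℕ) (hn : 0 < n) (m : ℤ)
    (hsmul : ∀ (a : L) x, F (a • x) = s a • F x) (z : L) (hz : v z = exp (-1))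
    (hF : ∀ x, F^[n] x = z ^ m • x)
    {i : ℕ} (hi : i < n) (x) :
    fnorm v F n m (F^[i] x) = exp (-(m * i)) * fnorm v F n m x := by
  have key : ∀ (i : ℕ) x, fnorm v F n m (F^[i] x) ≤ exp (-(m * i)) * fnorm v F n m x := by
    intro i x
    induction i with
    | zero => simp
    | succ i ih =>
      rw [Function.iterate_succ_apply']
      refine (fnorm_F_le v F n hn m z hz hF _).trans ?_
      refine (mul_le_mul_right ih _).trans (le_of_eq ?_)
      rw [← mul_assoc, ← exp_add]
      congr 2
      push_cast
      ring
  apply le_antisymm (key i x)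
  have hz0 : z ≠ 0 := by
    rintro rfl
    rw [map_zero] at hz
    exact exp_ne_zero hz.symm
  have h := key (n - i) (F^[i] x)
  rw [← Function.iterate_add_apply, Nat.sub_add_cancel hi.le, hF,
    fnorm_smul s v hvs F n m hsmul (zpow_ne_zero _ hz0), map_zpow₀, hz, ← exp_zsmul,
    ← exp_nsmul] at h
  have h2 := mul_le_mul_right h (exp (m * (n - i : ℕ)))
  rw [← mul_assoc, ← mul_assoc, ← exp_add, ← exp_add] at h2
  rw [add_neg_cancel, exp_zero, one_mul] at h2
  refine le_trans (le_of_eq ?_) h2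
  congr 2
  rw [Nat.cast_sub hi.le]
  simp
  ring

lemma F_independent (s : L →+* L) (v : Valuation L ℤᵐ⁰) (hvs : ∀ x, v (s x) = v x)
    (F : (Fin r → L) → (Fin r → L)) (n : ℕ) (hn : 0 < n) (m : ℤ)
    (hadd : ∀ x y, F (x + y) = F x + F y) (hsmul : ∀ (a : L) x, F (a • x) = s a • F x) (z : L)
    (hz : v z = exp (-1)) (hF : ∀ x, F^[n] x = z ^ m • x)
    (hmn : IsCoprime m (n : ℤ)) {x : Fin r → L} (hx : x ≠ 0) (a : Fin n → L)
    (ha : ∑ i, a i • F^[i] x = 0) : a = 0 := by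
  classical
  by_contra hne
  obtain ⟨i₁, hi₁⟩ : ∃ i, a i ≠ 0 := by
    by_contra h
    push Not at h
    exact hne (funext h)
  have hN : fnorm v F n m x ≠ 0 := fun h => hx (fnorm_eq_zero v F n hn m h)
  set f : Fin n → ℤᵐ⁰ := fun i => fnorm v F n m (a i • F^[i] x) with hf
  have hfi : ∀ i, a i ≠ 0 → f i = v (a i) ^ n * (exp (-(m * (i : ℕ))) * fnorm v F n m x) := by
    intro i hi
    rw [hf]
    simp only
    rw [fnorm_smul s v hvs F n m hsmul hi, fnorm_F_iter s v hvs F n hn m hsmul z hz hF i.2]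
  have hf0 : ∀ i, a i = 0 → f i = 0 := by
    intro i hi
    rw [hf]
    simp only
    rw [hi]
    apply le_antisymm _ zero_le'
    refine (fnorm_smul_le s v hvs F n m hsmul 0 _).trans ?_
    simp [hn.ne']
  have hinj : ∀ i j, a i ≠ 0 → a j ≠ 0 → f i = f j → i = j := by
    intro i j hi hj hij
    rw [hfi i hi, hfi j hj, ← mul_assoc, ← mul_assoc] at hij
    have h1 := mul_right_cancel₀ hN hij
    have h2 := congrArg log h1
    have hvi := (v.ne_zero_iff).2 hi
    have hvj := (v.ne_zero_iff).2 hj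
    rw [log_mul (pow_ne_zero _ hvi) exp_ne_zero, log_mul (pow_ne_zero _ hvj) exp_ne_zero,
      log_pow, log_pow, log_exp, log_exp] at h2
    simp only [nsmul_eq_mul] at h2
    have h3 : (n : ℤ) ∣ m * ((i : ℕ) - (j : ℕ) : ℤ) := ⟨log (v (a i)) - log (v (a j)), by
      linear_combination -h2⟩
    have h4 := hmn.symm.dvd_of_dvd_mul_left h3
    have h5 := Int.eq_zero_of_abs_lt_dvd h4 (by
      rw [abs_lt]; have := i.2; have := j.2; constructor <;> omega)
    apply Fin.ext
    omega
  obtain ⟨i₀, -, hmax⟩ := Finset.exists_max_image Finset.univ f ⟨i₁, Finset.mem_univ _⟩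
  have hpos1 : 0 < f i₁ := by
    rw [hfi i₁ hi₁, zero_lt_iff]
    exact mul_ne_zero (pow_ne_zero _ ((v.ne_zero_iff).2 hi₁)) (mul_ne_zero exp_ne_zero hN)
  have hpos : 0 < f i₀ := hpos1.trans_le (hmax i₁ (Finset.mem_univ _))
  have hi₀ : a i₀ ≠ 0 := fun h => hpos.ne' (hf0 _ h)
  have hlt : ∀ i ≠ i₀, f i < f i₀ := by
    intro i hi
    by_cases h : a i = 0
    · rw [hf0 i h]; exact hpos
    · exact lt_of_le_of_ne (hmax i (Finset.mem_univ _)) fun h' => hi (hinj i i₀ h hi₀ h')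
  have hsum : ∀ t : Finset (Fin n), i₀ ∉ t →
      fnorm v F n m (∑ i ∈ t, a i • F^[i] x) < f i₀ := by
    intro t
    induction t using Finset.induction_on with
    | empty =>
      intro _
      rw [Finset.sum_empty]
      have := fnorm_smul_le s v hvs F n m hsmul 0 0
      rw [zero_smul, map_zero, zero_pow hn.ne', zero_mul] at this
      exact this.trans_lt hpos
    | insert b t hb ih =>
      intro hbt
      rw [Finset.sum_insert hb]
      refine (fnorm_add v F n hn m hadd _ _).trans_lt (max_lt ?_ ?_)
      · exact hlt b fun h => hbt (h ▸ Finset.mem_insert_self _ _)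
      · exact ih fun h => hbt (Finset.mem_insert_of_mem h)
  rw [← Finset.add_sum_erase _ _ (Finset.mem_univ i₀)] at ha
  have h1 := hsum (Finset.univ.erase i₀) (Finset.notMem_erase _ _)
  have h2 : a i₀ • F^[i₀] x = (-1 : L) • ∑ i ∈ Finset.univ.erase i₀, a i • F^[i] x := by
    rw [neg_one_smul]; exact eq_neg_of_add_eq_zero_left ha
  have h3 := fnorm_smul_le s v hvs F n m hsmul (-1)
    (∑ i ∈ Finset.univ.erase i₀, a i • F^[i] x)
  rw [← h2, Valuation.map_neg, map_one, one_pow, one_mul] at h3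
  exact absurd (h3.trans_lt h1) (lt_irrefl _)

end Division

section Division2

open WithZero Multiplicative

variable {L : Type*} [Field L] {r : ℕ}

lemma s_bijective (s : L →+* L) (n : ℕ) (hn : 0 < n) (hs : ∀ x, s^[n] x = x)
    : Function.Bijective s := by
  obtain ⟨k, rfl⟩ : ∃ k, n = k + 1 := ⟨n - 1, by omega⟩
  refine ⟨s.injective, fun x => ⟨s^[k] x, ?_⟩⟩
  rw [← Function.iterate_succ_apply' s, hs]

lemma mem_of_comb_mem (s : L →+* L) (v : Valuation L ℤᵐ⁰) (hvs : ∀ x, v (s x) = v x)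
    (F : (Fin r → L) → (Fin r → L)) (n : ℕ) (hn : 0 < n) (hs : ∀ x, s^[n] x = x) (m : ℤ)
    (hadd : ∀ x y, F (x + y) = F x + F y) (hsmul : ∀ (a : L) x, F (a • x) = s a • F x) (z : L)
    (hz : v z = exp (-1)) (hF : ∀ x, F^[n] x = z ^ m • x)
    (hmn : IsCoprime m (n : ℤ)) (W : Submodule L (Fin r → L))
    (hW : ∀ x ∈ W, F x ∈ W) (a : Fin n → L) (ha : a ≠ 0) (x : Fin r → L)
    (hx : ∑ i, a i • F^[i] x ∈ W) : x ∈ W := by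
  classical
  let s' : L ≃+* L := RingEquiv.ofBijective s (s_bijective s n hn hs)
  have hs' : s' ^ n = 1 := by
    ext y
    have : ∀ k : ℕ, (s' ^ k) y = s^[k] y := by
      intro k
      induction k with
      | zero => rfl
      | succ k ih => rw [pow_succ', Function.iterate_succ_apply', ← ih]; rfl
    rw [this, hs]; rfl
  have hfo : IsOfFinOrder s' := isOfFinOrder_iff_pow_eq_one.2 ⟨n, hn, hs'⟩
  let G := Subgroup.zpowers s'
  have : Finite G := by
    have := hfo.finite_zpowers
    exact this
  let K₀ := FixedPoints.subfield G L
  have : FiniteDimensional K₀ L := inferInstance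
  have hK : ∀ k : K₀, s (k : L) = k := fun k => k.2 ⟨s', Subgroup.mem_zpowers s'⟩
  have hK' : ∀ (i : ℕ) (k : K₀), s^[i] (k : L) = k := by
    intro i k
    induction i with
    | zero => rfl
    | succ i ih => rw [Function.iterate_succ_apply', ih, hK]
  let u : (Fin r → L) →ₗ[K₀] (Fin r → L) :=
    { toFun := fun x => ∑ i, a i • F^[i] x
      map_add' := fun x y => by
        simp only [F_iter_add F hadd, smul_add, Finset.sum_add_distrib]
      map_smul' := fun k x => by
        have : k • x = (k : L) • x := rfl
        simp only [this, F_iter_smul s F hsmul, hK', RingHom.id_apply]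
        have h2 : ∀ y : Fin r → L, k • y = (k : L) • y := fun _ => rfl
        rw [h2, Finset.smul_sum]
        exact Finset.sum_congr rfl fun i _ => smul_comm _ _ _ }
  have hinj : Function.Injective u := by
    rw [← LinearMap.ker_eq_bot, LinearMap.ker_eq_bot']
    intro y hy
    by_contra hy0
    exact ha (F_independent s v hvs F n hn m hadd hsmul z hz hF hmn hy0 a hy)
  have hWi : ∀ (i : ℕ), ∀ y ∈ W, F^[i] y ∈ W := by
    intro i y hy
    induction i with
    | zero => exact hy
    | succ i ih => rw [Function.iterate_succ_apply']; exact hW _ ih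
  have hmaps : ∀ y ∈ W.restrictScalars K₀, u y ∈ W.restrictScalars K₀ := by
    intro y hy
    have : ∑ i, a i • F^[i] y ∈ W := W.sum_mem fun i _ => W.smul_mem _ (hWi i y hy)
    exact this
  have : Module.Finite K₀ (Fin r → L) := Module.Finite.trans L _
  let u' := u.restrict hmaps
  have hinj' : Function.Injective u' := by
    intro y y' h
    exact Subtype.ext (hinj (congrArg Subtype.val h))
  have hsurj := LinearMap.injective_iff_surjective.1 hinj'
  obtain ⟨y, hy⟩ := hsurj ⟨u x, hx⟩
  have : u y = u x := congrArg Subtype.val hy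
  rw [← hinj this]
  exact y.2

lemma exists_F_basis (s : L →+* L) (v : Valuation L ℤᵐ⁰) (hvs : ∀ x, v (s x) = v x)
    (F : (Fin r → L) → (Fin r → L)) (n : ℕ) (hn : 0 < n) (hs : ∀ x, s^[n] x = x) (m : ℤ)
    (hadd : ∀ x y, F (x + y) = F x + F y) (hsmul : ∀ (a : L) x, F (a • x) = s a • F x) (z : L)
    (hz : v z = exp (-1)) (hF : ∀ x, F^[n] x = z ^ m • x)
    (hmn : IsCoprime m (n : ℤ)) :
    ∃ (k : ℕ) (w : Fin k → (Fin r → L)),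
      LinearIndependent L (fun i : Fin n × Fin k => F^[i.1] (w i.2)) ∧
      Submodule.span L (Set.range (fun i : Fin n × Fin k => F^[i.1] (w i.2))) = ⊤ := by
  classical
  by_contra hcon
  push Not at hcon
  have key : ∀ k : ℕ, ∃ w : Fin k → (Fin r → L),
      LinearIndependent L (fun i : Fin n × Fin k => F^[i.1] (w i.2)) := by
    intro k
    induction k with
    | zero => exact ⟨Fin.elim0, linearIndependent_empty_type⟩
    | succ k ih =>
      obtain ⟨w, hw⟩ := ih
      have hne := hcon k w hw
      set W := Submodule.span L (Set.range (fun i : Fin n × Fin k => F^[i.1] (w i.2))) with hWdef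
      obtain ⟨x, hx⟩ : ∃ x, x ∉ W := by
        by_contra h
        push Not at h
        exact hne (Submodule.eq_top_iff'.2 h)
      have hW : ∀ y ∈ W, F y ∈ W := by
        intro y hy
        induction hy using Submodule.span_induction with
        | mem y hy =>
          obtain ⟨⟨i, j⟩, rfl⟩ := hy
          simp only
          rw [← Function.iterate_succ_apply' F]
          rcases Nat.lt_or_ge (i + 1) n with h | h
          · exact Submodule.subset_span ⟨(⟨i + 1, h⟩, j), rfl⟩
          · have : (i : ℕ).succ = n := by have := i.2; omega
            rw [this, hF]
            exact W.smul_mem _ (Submodule.subset_span ⟨(⟨0, hn⟩, j), rfl⟩)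
        | zero =>
          have := hsmul 0 0
          rw [zero_smul, map_zero, zero_smul] at this
          rw [this]; exact W.zero_mem
        | add y y' _ _ h h' => rw [hadd]; exact W.add_mem h h'
        | smul c y _ h => rw [hsmul]; exact W.smul_mem _ h
      refine ⟨Fin.cons x w, ?_⟩
      rw [Fintype.linearIndependent_iff] at hw ⊢
      intro g hg
      rw [Fintype.sum_prod_type] at hg
      simp only [Fin.sum_univ_succ, Fin.cons_zero, Fin.cons_succ, Finset.sum_add_distrib] at hg
      have h0 : (fun i => g (i, 0)) = 0 := by
        by_contra hg0
        apply hx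
        refine mem_of_comb_mem s v hvs F n hn hs m hadd hsmul z hz hF hmn W hW _ hg0 x ?_
        rw [eq_neg_of_add_eq_zero_left hg]
        exact W.neg_mem (W.sum_mem fun i _ => W.sum_mem fun j _ =>
          W.smul_mem _ (Submodule.subset_span ⟨(i, j), rfl⟩))
      have h0' : ∀ i, g (i, 0) = 0 := fun i => congrFun h0 i
      simp only [h0', zero_smul, Finset.sum_const_zero, zero_add] at hg
      have h1 := hw (fun ij => g (ij.1, ij.2.succ)) (by rw [Fintype.sum_prod_type]; exact hg)
      rintro ⟨i, j⟩
      refine Fin.cases (h0' i) (fun j => h1 (i, j)) j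
  obtain ⟨w, hw⟩ := key (r + 1)
  have := hw.fintype_card_le_finrank
  simp at this
  nlinarith

end Division2

/-- Matrices with one nonzero entry per column, a power of `z`. -/
def monoMat {A : Type*} [CommRing A] {r : ℕ} (t : ℤ → A) (π : Fin r → Fin r) (d : Fin r → ℤ) :
    Matrix (Fin r) (Fin r) A := fun i j => if i = π j then t (d j) else 0

lemma exists_monomial {L : Type*} [Field L] {r : ℕ}
    (s : L →+* L) (v : Valuation L (WithZero (Multiplicative ℤ))) (hvs : ∀ x, v (s x) = v x)
    (n : ℕ) (hn : 0 < n) (hs : ∀ x, s^[n] x = x) (m : ℤ) (z : L) (hz : v z = WithZero.exp (-1))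
    (hmn : IsCoprime m (n : ℤ))
    (c : Matrix (Fin r) (Fin r) L) (hc : nm s.mapMatrix c n = z ^ m • 1) :
    ∃ (x : Matrix (Fin r) (Fin r) L) (π : Fin r → Fin r) (d : Fin r → ℤ), IsUnit x ∧
      c * s.mapMatrix x = x * monoMat (fun k => z ^ k) π d := by
  classical
  let F : (Fin r → L) → (Fin r → L) := fun x => c.mulVec (s ∘ x)
  have hadd : ∀ x y, F (x + y) = F x + F y := by
    intro x y
    have : s ∘ (x + y) = s ∘ x + s ∘ y := by ext; simp
    simp only [F, this, Matrix.mulVec_add]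
  have hsmul : ∀ (a : L) x, F (a • x) = s a • F x := by
    intro a x
    have : s ∘ (a • x) = s a • (s ∘ x) := by ext; simp
    simp only [F, this, Matrix.mulVec_smul]
  have hFi : ∀ (i : ℕ) x, F^[i] x = (nm s.mapMatrix c i).mulVec (s^[i] ∘ x) := by
    intro i x
    induction i with
    | zero => simp [nm]
    | succ i ih =>
      rw [Function.iterate_succ_apply', ih, nm_succ', ← Matrix.mulVec_mulVec]
      simp only [F]
      congr 1
      rw [Function.iterate_succ']
      funext j
      simp only [Function.comp_apply, Matrix.mulVec, dotProduct, map_sum, map_mul]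
      rfl
  have hF : ∀ x, F^[n] x = z ^ m • x := by
    intro x
    rw [hFi, hc]
    have : s^[n] ∘ x = x := by ext j; exact hs _
    rw [this, Matrix.smul_mulVec, Matrix.one_mulVec]
  obtain ⟨k, w, hli, hsp⟩ := exists_F_basis s v hvs F n hn hs m hadd hsmul z hz hF hmn
  let B := Module.Basis.mk hli hsp.ge
  have hB : ∀ i, B i = F^[i.1] (w i.2) := fun i => Module.Basis.mk_apply hli hsp.ge i
  have hcard : Fintype.card (Fin r) = Fintype.card (Fin n × Fin k) := by
    have := Module.finrank_eq_card_basis B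
    rw [← this]; simp
  let e : Fin r ≃ Fin n × Fin k := Fintype.equivOfCardEq hcard
  let B' := B.reindex e.symm
  let x : Matrix (Fin r) (Fin r) L := fun i j => B' j i
  have hx : IsUnit x := by
    have h1 : x = (Pi.basisFun L (Fin r)).toMatrix B' := by
      ext i j
      simp [x, Module.Basis.toMatrix_apply]
    rw [h1]
    have := (Pi.basisFun L (Fin r)).invertibleToMatrix B'
    exact isUnit_of_invertible _
  have hFB : ∀ ij : Fin n × Fin k, ∃ (ij' : Fin n × Fin k) (d : ℤ), F (B ij) = z ^ d • B ij' := by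
    rintro ⟨i, j⟩
    rw [hB]
    simp only
    rw [← Function.iterate_succ_apply' F]
    rcases Nat.lt_or_ge (i + 1) n with h | h
    · refine ⟨(⟨i + 1, h⟩, j), 0, ?_⟩
      rw [hB]; simp
    · have : (i : ℕ).succ = n := by have := i.2; omega
      refine ⟨(⟨0, hn⟩, j), m, ?_⟩
      rw [this, hF, hB]; simp
  choose π d hπ using hFB
  refine ⟨x, fun j => e.symm (π (e j)), fun j => d (e j), hx, ?_⟩
  ext i j
  have h1 : (c * s.mapMatrix x) i j = F (B (e j)) i := by
    simp only [Matrix.mul_apply, F, Matrix.mulVec, dotProduct]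
    refine Finset.sum_congr rfl fun l _ => ?_
    have : s.mapMatrix x l j = s (x l j) := rfl
    rw [this]
    have h2 : x l j = B (e j) l := by simp [x, B']
    rw [h2]; rfl
  rw [h1, hπ]
  rw [Matrix.mul_apply]
  have h2 : ∀ l, x i l = B (e l) i := by intro l; simp [x, B']
  simp only [monoMat, h2, mul_ite, mul_zero, Finset.sum_ite_eq', Finset.mem_univ, if_true,
    Equiv.apply_symm_apply, Pi.smul_apply, smul_eq_mul]
  rw [mul_comm]

/-! ### Hilbert 90 -/

lemma hilbert90 {K : Type*} [Field K] {r : ℕ} (t : K →+* K) (g : ℕ) (hg : 0 < g) (a : K)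
    (ha : Function.Injective fun i : Fin g => t^[i] a) (hag : t^[g] a = a)
    (C : Matrix (Fin r) (Fin r) K) (hC : nm t.mapMatrix C g = 1) :
    ∃ x : Matrix (Fin r) (Fin r) K, IsUnit x ∧ C * t.mapMatrix x = x := by
  classical
  let X : ℕ → Matrix (Fin r) (Fin r) K := fun k =>
    ∑ i ∈ Finset.range g, (t^[i] a) ^ k • nm t.mapMatrix C i
  have hX : ∀ k, C * t.mapMatrix (X k) = X k := by
    intro k
    have h1 : C * t.mapMatrix (X k) =
        ∑ i ∈ Finset.range g, (t^[i + 1] a) ^ k • nm t.mapMatrix C (i + 1) := by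
      simp only [X]
      rw [map_sum, Finset.mul_sum]
      refine Finset.sum_congr rfl fun i _ => ?_
      have : t.mapMatrix ((t^[i] a) ^ k • nm t.mapMatrix C i) =
          (t^[i + 1] a) ^ k • t.mapMatrix (nm t.mapMatrix C i) := by
        ext u w
        simp [Function.iterate_succ_apply']
      rw [this, Matrix.mul_smul, nm_succ']
    rw [h1]
    have h2 := Finset.sum_range_succ' (fun i => (t^[i] a) ^ k • nm t.mapMatrix C i) g
    rw [Finset.sum_range_succ, hag, hC] at h2
    simp only [Function.iterate_zero, id, nm] at h2
    exact (add_right_cancel h2).symm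
  let S : Set (Fin r → K) := Set.range fun kj : ℕ × Fin r => fun i => X kj.1 i kj.2
  have hS : ∀ w ∈ S, C.mulVec (t ∘ w) = w := by
    rintro _ ⟨⟨k, j⟩, rfl⟩
    funext i
    have := congrFun (congrFun (hX k) i) j
    rw [Matrix.mul_apply] at this
    exact this
  have hspan : Submodule.span K S = ⊤ := by
    by_contra hne
    obtain ⟨f, hf0, hf⟩ := Submodule.exists_le_ker_of_lt_top _ (lt_top_iff_ne_top.2 hne)
    apply hf0
    refine LinearMap.pi_ext' fun j => LinearMap.ext_ring ?_
    have h1 : ∀ k : ℕ, ∑ i : Fin g, f (fun l => nm t.mapMatrix C i l j) * (t^[i] a) ^ k = 0 := by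
      intro k
      have h2 : f (fun i => X k i j) = 0 := hf (Submodule.subset_span ⟨(k, j), rfl⟩)
      rw [← h2]
      have h3 : (fun i => X k i j) =
          ∑ i : Fin g, (t^[i] a) ^ k • (fun l => nm t.mapMatrix C i l j) := by
        funext l
        simp only [X, Finset.sum_apply, Matrix.sum_apply, Pi.smul_apply, Matrix.smul_apply]
        exact (Fin.sum_univ_eq_sum_range (fun i => (t^[i] a) ^ k • nm t.mapMatrix C i l j) g).symm
      rw [h3, map_sum]
      exact Finset.sum_congr rfl fun i _ => by rw [map_smul, smul_eq_mul, mul_comm]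
    have h4 := Matrix.eq_zero_of_forall_pow_sum_mul_pow_eq_zero ha (fun i => h1 i)
    have h5 := congrFun h4 ⟨0, hg⟩
    simp only [nm, Pi.zero_apply] at h5
    simp only [LinearMap.coe_comp, Function.comp_apply, LinearMap.coe_single,
      LinearMap.zero_apply]
    rw [← h5]
    congr 1
    funext l
    simp [Matrix.one_apply, Pi.single_apply]
  obtain ⟨b, hbS, hbspan, hbli⟩ := exists_linearIndependent K S
  let B := Module.Basis.mk hbli (by simp [hbspan, hspan])
  have hB : ∀ i, B i = i := fun i => Module.Basis.mk_apply hbli _ i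
  let e := B.indexEquiv (Pi.basisFun K (Fin r))
  let B' := B.reindex e
  let x : Matrix (Fin r) (Fin r) K := fun i j => B' j i
  refine ⟨x, ?_, ?_⟩
  · have h1 : x = (Pi.basisFun K (Fin r)).toMatrix B' := by
      ext i j
      simp [x, Module.Basis.toMatrix_apply]
    rw [h1]
    have := (Pi.basisFun K (Fin r)).invertibleToMatrix B'
    exact isUnit_of_invertible _
  · ext i j
    have h1 : B' j ∈ S := by
      have : B' j = B (e.symm j) := by simp [B']
      rw [this, hB]
      exact hbS (e.symm j).2
    have h2 := congrFun (hS _ h1) i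
    rw [Matrix.mul_apply]
    exact h2

open WithZero in
/-- The `z`-adic valuation. -/
def zval (κ : Type*) [Field κ] : Valuation (LaurentSeries κ) (WithZero (Multiplicative ℤ)) where
  toFun x := if x = 0 then 0 else exp (-x.order)
  map_zero' := by simp
  map_one' := by simp
  map_mul' x y := by
    by_cases hx : x = 0
    · simp [hx]
    by_cases hy : y = 0
    · simp [hy]
    simp only [hx, hy, mul_ne_zero hx hy, if_false, ← exp_add, HahnSeries.order_mul hx hy]
    congr 1
    ring
  map_add_le_max' x y := by
    by_cases hxy : x + y = 0
    · simp [hxy]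
    by_cases hx : x = 0
    · simp [hx]
    by_cases hy : y = 0
    · simp [hy]
    simp only [hx, hy, hxy, if_false]
    have := HahnSeries.min_order_le_order_add hxy
    rcases min_le_iff.1 this with h | h
    · exact le_max_of_le_left (exp_le_exp.2 (neg_le_neg h))
    · exact le_max_of_le_right (exp_le_exp.2 (neg_le_neg h))

open WithZero in
lemma zval_z (κ : Type*) [Field κ] : zval κ (zPow 1) = exp (-1) := by
  have h : (zPow 1 : LaurentSeries κ) ≠ 0 := by simp [zPow]
  change (if (zPow 1 : LaurentSeries κ) = 0 then 0 else exp (-(zPow 1 : LaurentSeries κ).order)) = _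
  rw [if_neg h, zPow, HahnSeries.order_single one_ne_zero]

lemma zval_sg {κ : Type*} [Field κ] {p e : ℕ} [Fact p.Prime] [ExpChar κ p] (x : LaurentSeries κ) :
    zval κ (sg p e κ x) = zval κ x := by
  have hc : ∀ n, (sg p e κ x).coeff n = 0 ↔ x.coeff n = 0 := by
    intro n
    rw [sg_coeff]
    exact pow_eq_zero_iff (pow_ne_zero _ (Fact.out : p.Prime).ne_zero)
  have h0 : sg p e κ x = 0 ↔ x = 0 := by
    constructor
    · intro h; ext n; rw [HahnSeries.coeff_zero, ← hc, h, HahnSeries.coeff_zero]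
    · rintro rfl; simp
  change (if sg p e κ x = 0 then 0 else WithZero.exp (-(sg p e κ x).order)) =
    (if x = 0 then 0 else WithZero.exp (-x.order))
  by_cases hx : x = 0
  · simp [hx]
  · have hx' := mt h0.1 hx
    rw [if_neg hx, if_neg hx']
    congr 2
    apply le_antisymm
    · exact HahnSeries.order_le_of_coeff_ne_zero ((hc _).not.2 (HahnSeries.coeff_order_eq_zero.not.2 hx))
    · exact HahnSeries.order_le_of_coeff_ne_zero
        ((hc _).not.1 (HahnSeries.coeff_order_eq_zero.not.2 hx'))

lemma zPow_eq_zpow {κ : Type*} [Field κ] (k : ℤ) : (zPow 1 : LaurentSeries κ) ^ k = zPow k := by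
  have h : (zPow 1 : LaurentSeries κ) ≠ 0 := by simp [zPow]
  induction k with
  | zero => simp [zPow_zero]
  | succ k ih => rw [zpow_add_one₀ h, ih, ← zPow_add]
  | pred k ih =>
    rw [zpow_sub_one₀ h, ih, mul_inv_eq_iff_eq_mul₀ h, ← zPow_add]
    simp

/-! ### Isoclinic elements over an algebraically closed field -/

lemma exists_generator {κ : Type*} [Field κ] [IsAlgClosed κ] {p : ℕ} [Fact p.Prime] [CharP κ p]
    {e : ℕ} (he : 1 ≤ e) (h' g : ℕ) (hh : 0 < h' * g) :
    ∃ a : κ, a ^ (p ^ e) ^ (h' * g) = a ∧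
      Function.Injective fun i : Fin g => a ^ (p ^ e) ^ (h' * i) := by
  have hp := (Fact.out : p.Prime)
  have hq : 2 ≤ p ^ e := hp.two_le.trans (Nat.le_self_pow (by omega) p)
  set q := p ^ e with hqdef
  have hh' : 0 < h' := Nat.pos_of_mul_pos_right hh
  have hg : 0 < g := Nat.pos_of_mul_pos_left hh
  have hqh : 2 ≤ q ^ (h' * g) := hq.trans (Nat.le_self_pow (by omega) q)
  have hne : NeZero ((q ^ (h' * g) - 1 : ℕ) : κ) := ⟨by
    rw [Nat.cast_sub (by omega), Nat.cast_pow, hqdef, Nat.cast_pow, CharP.cast_eq_zero,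
      zero_pow (by omega), zero_pow (by omega)]
    simp⟩
  obtain ⟨a, ha⟩ := HasEnoughRootsOfUnity.exists_primitiveRoot κ (q ^ (h' * g) - 1)
  refine ⟨a, ?_, ?_⟩
  · have := ha.pow_eq_one
    calc a ^ q ^ (h' * g) = a ^ (q ^ (h' * g) - 1 + 1) := by congr 1; omega
      _ = a := by rw [pow_succ, this, one_mul]
  · intro i j hij
    rcases Nat.lt_or_ge 1 g with hg1 | hg1
    · have hlt : ∀ i : Fin g, q ^ (h' * i) < q ^ (h' * g) - 1 := by
        intro i
        have h1 : h' * i + 1 ≤ h' * g := by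
          have := i.2
          nlinarith
        have h1' : h' * i ≤ h' * g - 1 := by omega
        have h2 : q ^ (h' * i) ≤ q ^ (h' * g - 1) := Nat.pow_le_pow_right (by omega) h1'
        have h3 : q ^ (h' * g) = q ^ (h' * g - 1) * q := by
          rw [← pow_succ]; congr 1; omega
        have h4 : 2 ≤ q ^ (h' * g - 1) := by
          refine hq.trans (Nat.le_self_pow ?_ q)
          have : 2 ≤ h' * g := by nlinarith
          omega
        have h5 : q ^ (h' * g - 1) * 2 ≤ q ^ (h' * g - 1) * q := Nat.mul_le_mul_left _ hq
        omega
      have h1 := ha.pow_inj (hlt i) (hlt j) hij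
      have h2 := Nat.pow_right_injective hq h1
      exact Fin.ext (Nat.eq_of_mul_eq_mul_left hh' h2)
    · exact Fin.ext (by have := i.2; have := j.2; omega)

lemma nm_smul {K : Type*} [CommRing K] {r : ℕ} (t : K →+* K) (w : K) (hw : t w = w)
    (c : Matrix (Fin r) (Fin r) K) (n : ℕ) :
    nm t.mapMatrix (w • c) n = w ^ n • nm t.mapMatrix c n := by
  have h1 : ∀ M : Matrix (Fin r) (Fin r) K, t.mapMatrix (w • M) = w • t.mapMatrix M := by
    intro M
    ext i j
    simp [hw]
  induction n with
  | zero => simp [nm]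
  | succ n ih =>
    have h2 : (t.mapMatrix)^[n] (w • c) = w • (t.mapMatrix)^[n] c := by
      clear ih
      induction n with
      | zero => simp
      | succ n ih => rw [Function.iterate_succ_apply', ih, h1, Function.iterate_succ_apply']
    rw [nm, ih, h2, nm, Matrix.smul_mul, Matrix.mul_smul, smul_smul, pow_succ]

lemma zPow_pow {A : Type*} [CommRing A] (k : ℤ) (n : ℕ) :
    (zPow k : LaurentSeries A) ^ n = zPow (k * n) := by
  induction n with
  | zero => simp [zPow_zero]
  | succ n ih => rw [pow_succ, ih, ← zPow_add]; congr 1; push_cast; ring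

lemma nm_one {S : Type*} [Ring S] (s : S →+* S) (n : ℕ) : nm s 1 n = 1 := by
  induction n with
  | zero => rfl
  | succ n ih => rw [nm, ih, iterate_map_one, mul_one]

lemma mapMatrix_iter {K : Type*} [CommRing K] {r : ℕ} (t : K →+* K) (n : ℕ)
    (M : Matrix (Fin r) (Fin r) K) : (t ^ n).mapMatrix M = (t.mapMatrix)^[n] M := by
  induction n with
  | zero => ext; simp
  | succ n ih =>
    rw [Function.iterate_succ_apply', ← ih, pow_succ']
    rfl

/-- Reduction to a slope in lowest terms. -/
lemma reduce_slope {κ : Type*} [Field κ] [IsAlgClosed κ] {p : ℕ} [Fact p.Prime] [CharP κ p]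
    {e : ℕ} (he : 1 ≤ e) {r : ℕ} (c : Matrix (Fin r) (Fin r) (LaurentSeries κ)) (n g : ℕ)
    (hh : 0 < n * g) (m : ℤ)
    (hc : nm (msg p e κ r) c (n * g) = (zPow (m * g) : LaurentSeries κ) • 1) :
    ∃ x : Matrix (Fin r) (Fin r) (LaurentSeries κ), IsUnit x ∧
      nm (msg p e κ r) (x⁻¹ * c * msg p e κ r x) n = (zPow m : LaurentSeries κ) • 1 := by
  obtain ⟨a, ha, hinj⟩ := exists_generator (κ := κ) (p := p) he n g hh
  have hg : 0 < g := Nat.pos_of_mul_pos_left hh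
  let t := (sg p e κ) ^ n
  have ht : ∀ M : Matrix (Fin r) (Fin r) (LaurentSeries κ),
      t.mapMatrix M = (msg p e κ r)^[n] M := mapMatrix_iter (sg p e κ) n
  have htC : ∀ (k : ℕ) (b : κ), t^[k] (HahnSeries.C b) = HahnSeries.C (b ^ (p ^ e) ^ (n * k)) := by
    intro k b
    have h1 : ∀ b : κ, sg p e κ (HahnSeries.C b) = HahnSeries.C (b ^ p ^ e) := by
      intro b
      ext i
      rw [sg_coeff, HahnSeries.C_apply, HahnSeries.C_apply, HahnSeries.coeff_single,
        HahnSeries.coeff_single]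
      split_ifs with h
      · rfl
      · exact zero_pow (pow_ne_zero _ (Fact.out : p.Prime).ne_zero)
    have h2 : t^[k] (HahnSeries.C b) = (sg p e κ)^[n * k] (HahnSeries.C b) := by
      rw [Function.iterate_mul]; rfl
    rw [h2]
    generalize n * k = l
    induction l with
    | zero => simp
    | succ l ih => rw [Function.iterate_succ_apply', ih, h1, ← pow_mul, ← pow_succ]
  have htz : ∀ k : ℤ, t (zPow k) = zPow k := by
    intro k
    have : ∀ l : ℕ, (sg p e κ)^[l] (zPow k) = zPow k := by
      intro l
      induction l with
      | zero => rfl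
      | succ l ih => rw [Function.iterate_succ_apply', ih, sg_zPow]
    exact this n
  let C := (zPow (-m) : LaurentSeries κ) • nm (msg p e κ r) c n
  have hC : nm t.mapMatrix C g = 1 := by
    rw [nm_smul t _ (htz _), ← nm_mul (msg p e κ r) c n t.mapMatrix ht, hc, smul_smul, zPow_pow,
      ← zPow_add]
    have : -m * (g : ℤ) + m * g = 0 := by ring
    rw [this, zPow_zero, one_smul]
  obtain ⟨x, hx, hxC⟩ := hilbert90 t g hg (HahnSeries.C a) (by
      intro i j hij
      simp only [htC] at hij
      exact hinj (HahnSeries.C_injective hij)) (by rw [htC, ha]) C hC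
  refine ⟨x, hx, ?_⟩
  have hdet := (Matrix.isUnit_iff_isUnit_det x).1 hx
  rw [nm_conj _ (Matrix.nonsing_inv_mul x hdet) (Matrix.mul_nonsing_inv x hdet)]
  have h1 : nm (msg p e κ r) c n = (zPow m : LaurentSeries κ) • C := by
    simp only [C]
    rw [smul_smul, ← zPow_add, add_neg_cancel, zPow_zero, one_smul]
  rw [← ht, h1, Matrix.mul_smul, Matrix.smul_mul, mul_assoc, hxC, Matrix.nonsing_inv_mul x hdet]

/-- An isoclinic element of coprime slope is conjugate to a monomial matrix. -/
lemma monomial_of_coprime {κ : Type*} [Field κ] {p : ℕ} [Fact p.Prime] [CharP κ p]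
    {e : ℕ} {r : ℕ} (c : Matrix (Fin r) (Fin r) (LaurentSeries κ)) (n : ℕ)
    (hn : 0 < n) (m : ℤ) (hmn : IsCoprime m (n : ℤ))
    (hc : nm (msg p e κ r) c n = (zPow m : LaurentSeries κ) • 1) :
    ∃ (x : Matrix (Fin r) (Fin r) (LaurentSeries κ)) (π : Fin r → Fin r) (d : Fin r → ℤ),
      IsUnit x ∧ c * msg p e κ r x = x * monoMat zPow π d ∧ (msg p e κ r)^[n] x = x := by
  have hz0 : IsUnit (zPow m : LaurentSeries κ) := by
    refine IsUnit.of_mul_eq_one (zPow (-m)) ?_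
    rw [← zPow_add, add_neg_cancel, zPow_zero]
  have hfix : (msg p e κ r)^[n] c = c := by
    have h1 := nm_succ' (msg p e κ r) c n
    rw [nm, hc] at h1
    have h2 : msg p e κ r ((zPow m : LaurentSeries κ) • 1) = (zPow m : LaurentSeries κ) • 1 := by
      refine Matrix.ext fun i j => ?_
      change sg p e κ _ = _
      by_cases hij : i = j
      · subst hij; simp [sg_zPow]
      · simp [hij]
    rw [h2, Matrix.smul_mul, one_mul, Matrix.mul_smul, mul_one] at h1
    exact hz0.smul_left_cancel.1 h1
  let t := (sg p e κ) ^ n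
  let L := RingHom.eqLocusField t (RingHom.id _)
  have hL : ∀ x : LaurentSeries κ, x ∈ L ↔ (sg p e κ)^[n] x = x := fun x => Iff.rfl
  have hsL : ∀ x ∈ L, sg p e κ x ∈ L := by
    intro x hx
    rw [hL] at hx ⊢
    rw [← Function.iterate_succ_apply, Function.iterate_succ_apply', hx]
  let s : L →+* L := (sg p e κ).restrict L L hsL
  have hs1 : ∀ x : L, ((s x : L) : LaurentSeries κ) = sg p e κ x := fun x => rfl
  have hsi : ∀ (i : ℕ) (x : L), ((s^[i] x : L) : LaurentSeries κ) = (sg p e κ)^[i] x := by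
    intro i x
    induction i with
    | zero => rfl
    | succ i ih => rw [Function.iterate_succ_apply', Function.iterate_succ_apply', hs1, ih]
  have hzL : (zPow 1 : LaurentSeries κ) ∈ L := by
    rw [hL]
    generalize n = l
    induction l with
    | zero => rfl
    | succ l ih => rw [Function.iterate_succ_apply', ih, sg_zPow]
  let cL : Matrix (Fin r) (Fin r) L := fun i j => ⟨c i j, by
    rw [hL, ← msg_iter_apply, hfix]⟩
  let φ := L.subtype.mapMatrix (m := Fin r)
  have hφinj : Function.Injective φ := by
    intro M N h
    refine Matrix.ext fun i j => ?_
    exact Subtype.ext (congrFun (congrFun h i) j)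
  have hφs : ∀ M, φ (s.mapMatrix M) = msg p e κ r (φ M) := fun M => rfl
  have hφc : φ cL = c := rfl
  let zL : L := ⟨zPow 1, hzL⟩
  have hzLk : ∀ k : ℤ, ((zL ^ k : L) : LaurentSeries κ) = zPow k := by
    intro k
    rw [← zPow_eq_zpow]
    push_cast
    rfl
  have hcL : nm s.mapMatrix cL n = zL ^ m • 1 := by
    apply hφinj
    rw [nm_map _ (msg p e κ r) φ hφs, hφc, hc]
    refine Matrix.ext fun i j => ?_
    change _ = (((zL ^ m • (1 : Matrix (Fin r) (Fin r) L)) i j : L) : LaurentSeries κ)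
    by_cases hij : i = j
    · subst hij; simp [hzLk]
    · simp [hij]
  obtain ⟨x, π, d, hx, hcx⟩ := exists_monomial s ((zval κ).comap L.subtype)
    (fun x => zval_sg (x : LaurentSeries κ)) n hn (fun x => Subtype.ext (by rw [hsi]; exact x.2))
    m zL (zval_z κ) hmn cL hcL
  refine ⟨φ x, π, d, hx.map φ, ?_, ?_⟩
  · rw [← hφc, ← hφs, ← map_mul, hcx, map_mul]
    congr 1
    refine Matrix.ext fun i j => ?_
    change ((monoMat (fun k => zL ^ k) π d i j : L) : LaurentSeries κ) = monoMat zPow π d i j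
    simp only [monoMat]
    split_ifs
    · exact hzLk _
    · rfl
  · refine Matrix.ext fun i j => ?_
    rw [msg_iter_apply]
    exact (x i j).2

lemma closed_point {κ : Type*} [Field κ] [IsAlgClosed κ] {p : ℕ} [Fact p.Prime] [CharP κ p]
    {e : ℕ} (he : 1 ≤ e) {r : ℕ} (c : Matrix (Fin r) (Fin r) (LaurentSeries κ)) (h : ℕ)
    (hh : 1 ≤ h) (m : ℤ) (hc : nm (msg p e κ r) c h = (zPow m : LaurentSeries κ) • 1) :
    ∃ (x : Matrix (Fin r) (Fin r) (LaurentSeries κ)) (π : Fin r → Fin r) (d : Fin r → ℤ),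
      IsUnit x ∧ c * msg p e κ r x = x * monoMat zPow π d ∧
      nm (msg p e κ r) (monoMat zPow π d) h = (zPow m : LaurentSeries κ) • 1 := by
  obtain ⟨g, n, m', hg, hcop, rfl, rfl⟩ : ∃ (g n : ℕ) (m' : ℤ), 0 < g ∧ IsCoprime m' (n : ℤ) ∧
      h = n * g ∧ m = m' * g := by
    have hg : 0 < Int.gcd m h := Int.gcd_pos_of_ne_zero_right _ (by omega)
    obtain ⟨m', n', hcop, hm, hn⟩ := Int.exists_gcd_one hg
    have hn0 : 0 ≤ n' := by
      by_contra hneg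
      push Not at hneg
      have : (h : ℤ) < 0 := by rw [hn]; exact mul_neg_of_neg_of_pos hneg (by exact_mod_cast hg)
      omega
    lift n' to ℕ using hn0
    exact ⟨Int.gcd m h, n', m', hg, Int.isCoprime_iff_gcd_eq_one.2 hcop, by exact_mod_cast hn, hm⟩
  have hn : 0 < n := Nat.pos_of_mul_pos_right hh
  obtain ⟨x₁, hx₁, hc₁⟩ := reduce_slope he c n g hh m' hc
  obtain ⟨x₂, π, d, hx₂, hc₂, hfix⟩ := monomial_of_coprime _ n hn m' hcop hc₁
  have hd1 := (Matrix.isUnit_iff_isUnit_det x₁).1 hx₁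
  have hd2 := (Matrix.isUnit_iff_isUnit_det x₂).1 hx₂
  refine ⟨x₁ * x₂, π, d, hx₁.mul hx₂, ?_, ?_⟩
  · rw [mul_assoc x₁, ← hc₂, map_mul]
    simp only [← mul_assoc]
    rw [Matrix.mul_nonsing_inv x₁ hd1, one_mul]
  · have h1 : monoMat zPow π d =
        x₂⁻¹ * (x₁⁻¹ * c * msg p e κ r x₁) * msg p e κ r x₂ := by
      rw [mul_assoc, hc₂, ← mul_assoc, Matrix.nonsing_inv_mul x₂ hd2, one_mul]
    have h2 : nm (msg p e κ r) (monoMat zPow π d) n = (zPow m' : LaurentSeries κ) • 1 := by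
      rw [h1, nm_conj _ (Matrix.nonsing_inv_mul x₂ hd2) (Matrix.mul_nonsing_inv x₂ hd2), hc₁,
        hfix, Matrix.mul_smul, Matrix.smul_mul, mul_one, Matrix.nonsing_inv_mul x₂ hd2]
    have htz : ((sg p e κ) ^ n) (zPow m') = zPow m' := by
      rw [RingHom.coe_pow]
      generalize n = l
      induction l with
      | zero => rfl
      | succ l ih => rw [Function.iterate_succ_apply', ih, sg_zPow]
    rw [nm_mul (msg p e κ r) _ n ((sg p e κ) ^ n).mapMatrix (mapMatrix_iter (sg p e κ) n), h2,
      nm_smul _ _ htz, nm_one, zPow_pow]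

/-! ### Lifting from the residue field -/

section Lift

variable {R κ : Type*} [CommRing R] [Nontrivial R] [Field κ] (φ : R →+* κ)
  (hs : Function.Surjective φ)

lemma lift_series (hs : Function.Surjective φ) (x : LaurentSeries κ) :
    ∃ X : LaurentSeries R, lmapHom φ X = x ∧ ∀ n, x.coeff n = 0 → X.coeff n = 0 := by
  let s : ZeroHom κ R :=
    { toFun := fun a => if a = 0 then 0 else Function.surjInv hs a
      map_zero' := by simp }
  have hs0 : ∀ a, φ (s a) = a := by
    intro a
    change φ (if a = 0 then 0 else Function.surjInv hs a) = a
    split_ifs with h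
    · rw [h, map_zero]
    · exact Function.surjInv_eq hs a
  refine ⟨x.map s, ?_, ?_⟩
  · ext n
    rw [lmapHom_coeff, HahnSeries.map_coeff]
    exact hs0 _
  · intro n hn
    rw [HahnSeries.map_coeff, hn]
    exact s.map_zero

lemma lift_series_unit (hs : Function.Surjective φ) (hu : ∀ a, φ a ≠ 0 → IsUnit a)
    (x : LaurentSeries κ) (hx : x ≠ 0) :
    ∃ X : LaurentSeries R, lmapHom φ X = x ∧ IsUnit X := by
  obtain ⟨X, hX, hX0⟩ := lift_series φ hs x
  refine ⟨X, hX, ?_⟩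
  have hc : φ (X.coeff x.order) ≠ 0 := by
    rw [← lmapHom_coeff, hX]
    exact HahnSeries.coeff_order_eq_zero.not.2 hx
  have hc0 : X.coeff x.order ≠ 0 := fun h => hc (by rw [h, map_zero])
  have hXne : X ≠ 0 := by
    rintro rfl
    exact hc0 rfl
  have hord : X.order = x.order := by
    apply le_antisymm
    · exact HahnSeries.order_le_of_coeff_ne_zero hc0
    · refine HahnSeries.order_le_of_coeff_ne_zero fun h => ?_
      exact hXne (HahnSeries.coeff_order_eq_zero.1 (hX0 _ h))
  refine HahnSeries.isUnit_of_isUnit_leadingCoeff_AddUnitOrder ?_ ?_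
  · rw [HahnSeries.leadingCoeff_eq, hord]
    exact hu _ hc
  · exact AddGroup.isAddUnit _

lemma lift_matrix (hs : Function.Surjective φ) (hu : ∀ a, φ a ≠ 0 → IsUnit a) {r : ℕ}
    (g : Matrix (Fin r) (Fin r) (LaurentSeries κ)) (hg : IsUnit g) :
    ∃ G : Matrix (Fin r) (Fin r) (LaurentSeries R), IsUnit G ∧ (lmapHom φ).mapMatrix G = g := by
  have hd : g.det ≠ 0 := ((Matrix.isUnit_iff_isUnit_det g).1 hg).ne_zero
  refine Matrix.diagonal_transvection_induction_of_det_ne_zero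
    (fun g => ∃ G : Matrix (Fin r) (Fin r) (LaurentSeries R), IsUnit G ∧
      (lmapHom φ).mapMatrix G = g) g hd ?_ ?_ ?_
  · intro D hD
    rw [Matrix.det_diagonal] at hD
    have hD' : ∀ i, D i ≠ 0 := fun i => by
      have := Finset.prod_ne_zero_iff.1 hD i (Finset.mem_univ _)
      exact this
    choose E hE hEu using fun i => lift_series_unit φ hs hu (D i) (hD' i)
    refine ⟨Matrix.diagonal E, ?_, ?_⟩
    · rw [Matrix.isUnit_iff_isUnit_det, Matrix.det_diagonal]
      exact IsUnit.prod_univ_iff.2 hEu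
    · rw [RingHom.mapMatrix_apply, Matrix.diagonal_map (map_zero _)]
      congr 1
      exact funext hE
  · intro t
    obtain ⟨X, hX, -⟩ := lift_series φ hs t.c
    refine ⟨Matrix.transvection t.i t.j X, ?_, ?_⟩
    · rw [Matrix.isUnit_iff_isUnit_det, Matrix.det_transvection_of_ne _ _ t.hij]
      exact isUnit_one
    · rw [Matrix.TransvectionStruct.toMatrix, Matrix.transvection, Matrix.transvection, map_add,
        map_one, RingHom.mapMatrix_apply, Matrix.map_single, hX]
  · rintro A B - - ⟨G, hG, rfl⟩ ⟨H, hH, rfl⟩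
    exact ⟨G * H, hG.mul hH, map_mul _ _ _⟩

end Lift
/-! ### Congruences modulo an ideal -/

/-- Reduction of matrices of Laurent series modulo an ideal. -/
def redMat {R : Type*} [CommRing R] (I : Ideal R) (r : ℕ) :
    Matrix (Fin r) (Fin r) (LaurentSeries R) →+* Matrix (Fin r) (Fin r) (LaurentSeries (R ⧸ I)) :=
  (lmapHom (Ideal.Quotient.mk I)).mapMatrix

lemma redMat_eq_iff {R : Type*} [CommRing R] (I : Ideal R) {r : ℕ}
    (x y : Matrix (Fin r) (Fin r) (LaurentSeries R)) :
    redMat I r x = redMat I r y ↔ ∀ i j n, (x i j).coeff n - (y i j).coeff n ∈ I := by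
  constructor
  · intro h i j n
    rw [← Ideal.Quotient.eq]
    exact congrArg (fun s => HahnSeries.coeff s n) (congrFun (congrFun h i) j)
  · intro h
    refine Matrix.ext fun i j => ?_
    ext n
    exact Ideal.Quotient.eq.2 (h i j n)

lemma redMat_iter {R : Type*} [CommRing R] {p : ℕ} [Fact p.Prime] [ExpChar R p] {e : ℕ}
    (he : 1 ≤ e) (I : Ideal R) {r : ℕ} (x y : Matrix (Fin r) (Fin r) (LaurentSeries R))
    (h : redMat I r x = redMat I r y) (N n : ℕ) (hNn : N ≤ n) :
    redMat (I ^ N) r ((msg p e R r)^[n] x) = redMat (I ^ N) r ((msg p e R r)^[n] y) := by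
  rw [redMat_eq_iff] at h ⊢
  intro i j k
  rw [msg_iter_apply, msg_iter_apply, sg_iter_coeff, sg_iter_coeff, ← pow_mul,
    ← sub_pow_expChar_pow]
  have h1 : N ≤ p ^ (e * n) := by
    have h2 : n ≤ e * n := Nat.le_mul_of_pos_left n he
    have h3 : e * n < p ^ (e * n) := Nat.lt_pow_self (Fact.out : p.Prime).one_lt
    omega
  exact Ideal.pow_le_pow_right h1 (Ideal.pow_mem_pow (h i j k) _)

lemma redMat_frob {R : Type*} [CommRing R] {p : ℕ} [ExpChar R p] {e : ℕ}
    (I : Ideal R) {r : ℕ} (x y : Matrix (Fin r) (Fin r) (LaurentSeries R))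
    (h : redMat I r x = redMat I r y) :
    redMat I r (msg p e R r x) = redMat I r (msg p e R r y) := by
  rw [redMat_eq_iff] at h ⊢
  intro i j k
  have h1 : ∀ z : Matrix (Fin r) (Fin r) (LaurentSeries R),
      ((msg p e R r z) i j).coeff k = (z i j).coeff k ^ p ^ e := fun z => rfl
  rw [h1, h1]
  exact Ideal.mem_of_dvd _ (sub_dvd_pow_sub_pow _ _ _) (h i j k)

lemma eq_of_redMat {R : Type*} [CommRing R] (I : Ideal R) [IsHausdorff I R] {r : ℕ}
    (x y : Matrix (Fin r) (Fin r) (LaurentSeries R))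
    (h : ∀ N, redMat (I ^ N) r x = redMat (I ^ N) r y) : x = y := by
  refine Matrix.ext fun i j => ?_
  ext n
  rw [← sub_eq_zero]
  refine IsHausdorff.haus (I := I) inferInstance _ fun N => ?_
  rw [SModEq.zero, smul_eq_mul, Ideal.mul_top]
  exact (redMat_eq_iff _ _ _).1 (h N) i j n

lemma exists_redMat_limit {R : Type*} [CommRing R] (I : Ideal R) [IsPrecomplete I R] {r : ℕ}
    (u : ℕ → Matrix (Fin r) (Fin r) (LaurentSeries R)) (B : ℤ)
    (hB : ∀ l i j, InZPow B (u l i j))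
    (hu : ∀ N l, N ≤ l → redMat (I ^ N) r (u (l + 1)) = redMat (I ^ N) r (u l)) :
    ∃ f : Matrix (Fin r) (Fin r) (LaurentSeries R),
      ∀ N, redMat (I ^ N) r f = redMat (I ^ N) r (u N) := by
  have hu' : ∀ N k, redMat (I ^ N) r (u (N + k)) = redMat (I ^ N) r (u N) := by
    intro N k
    induction k with
    | zero => rfl
    | succ k ih => rw [← add_assoc, hu N (N + k) (by omega), ih]
  have key : ∀ i j n, ∃ a : R, (n < B → a = 0) ∧
      ∀ N, a - (u N i j).coeff n ∈ I ^ N := by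
    intro i j n
    by_cases hn : n < B
    · refine ⟨0, fun _ => rfl, fun N => ?_⟩
      rw [hB N i j n hn, sub_zero]
      exact zero_mem _
    · obtain ⟨a, ha⟩ := IsPrecomplete.prec (I := I) (M := R) inferInstance
        (f := fun N => (u N i j).coeff n) (by
          intro N l hNl
          obtain ⟨k, rfl⟩ := Nat.exists_eq_add_of_le hNl
          rw [SModEq.sub_mem, smul_eq_mul, Ideal.mul_top]
          exact (redMat_eq_iff _ _ _).1 (hu' N k).symm i j n)
      refine ⟨a, fun h => absurd h hn, fun N => ?_⟩
      have := (ha N).symm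
      rwa [SModEq.sub_mem, smul_eq_mul, Ideal.mul_top] at this
  choose a ha0 ha using key
  refine ⟨fun i j => HahnSeries.ofSuppBddBelow (a i j)
    ⟨B, fun n hn => not_lt.1 fun h => hn (ha0 i j n h)⟩, fun N => ?_⟩
  refine (redMat_eq_iff _ _ _).2 fun i j n => ?_
  exact ha i j n N

/-! ### The limit argument -/

section Limit

variable {R : Type*} [CommRing R] {p : ℕ} [Fact p.Prime] [ExpChar R p] {e r : ℕ}

/-- The approximating isogenies. -/
def apx (p e : ℕ) [ExpChar R p] (c b : Matrix (Fin r) (Fin r) (LaurentSeries R)) (n : ℕ) :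
    Matrix (Fin r) (Fin r) (LaurentSeries R) :=
  nm (msg p e R r) c n * (nm (msg p e R r) b n)⁻¹

lemma apx_mul (c : Matrix (Fin r) (Fin r) (LaurentSeries R))
    {b : Matrix (Fin r) (Fin r) (LaurentSeries R)} (hb : IsUnit b) (n : ℕ) :
    apx p e c b n * nm (msg p e R r) b n = nm (msg p e R r) c n := by
  have := (Matrix.isUnit_iff_isUnit_det _).1 (isUnit_nm (msg p e R r) hb n)
  rw [apx, mul_assoc, Matrix.nonsing_inv_mul _ this, mul_one]

lemma apx_mul_apx {c b : Matrix (Fin r) (Fin r) (LaurentSeries R)} (hc : IsUnit c)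
    (hb : IsUnit b) (n : ℕ) : apx p e c b n * apx p e b c n = 1 := by
  have h1 := apx_mul (p := p) (e := e) c hb n
  have h2 := apx_mul (p := p) (e := e) b hc n
  have h3 := isUnit_nm (msg p e R r) hc n
  refine h3.mul_right_cancel ?_
  rw [mul_assoc, h2, h1, one_mul]

lemma apx_step (he : 1 ≤ e) (I : Ideal R) {c b : Matrix (Fin r) (Fin r) (LaurentSeries R)}
    (hb : IsUnit b) (hcb : redMat I r b = redMat I r c) (N n k : ℕ) (hN : N ≤ n) :
    redMat (I ^ N) r (apx p e c b (n + k)) = redMat (I ^ N) r (apx p e c b n) := by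
  induction k with
  | zero => rfl
  | succ k ih =>
    rw [← ih, ← add_assoc]
    refine ((isUnit_nm (msg p e R r) hb (n + k + 1)).map (redMat (I ^ N) r)).mul_right_cancel ?_
    rw [← map_mul, ← map_mul, apx_mul _ hb, nm, nm, ← mul_assoc, apx_mul _ hb, map_mul, map_mul,
      redMat_iter he I b c hcb N (n + k) (by omega)]

lemma apx_frob {c b : Matrix (Fin r) (Fin r) (LaurentSeries R)} (hb : IsUnit b) (n : ℕ) :
    apx p e c b (n + 1) * b = c * msg p e R r (apx p e c b n) := by
  refine ((isUnit_nm (msg p e R r) hb n).map (msg p e R r)).mul_right_cancel ?_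
  rw [mul_assoc, ← nm_succ', apx_mul _ hb, mul_assoc, ← map_mul, apx_mul _ hb, nm_succ']

lemma limit_core (he : 1 ≤ e) (I : Ideal R) [IsAdicComplete I R]
    {c b : Matrix (Fin r) (Fin r) (LaurentSeries R)}
    (hc : IsUnit c) (hb : IsUnit b) (hcb : redMat I r b = redMat I r c) (h : ℕ) (hh : 1 ≤ h)
    (B : ℤ) (hB : ∀ l i j, InZPow B (apx p e c b (h * l) i j))
    (hB' : ∀ l i j, InZPow B (apx p e b c (h * l) i j)) :
    ∃ f : Matrix (Fin r) (Fin r) (LaurentSeries R), IsUnit f ∧ f * b = c * msg p e R r f := by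
  have hl : ∀ l, l ≤ h * l := fun l => Nat.le_mul_of_pos_left l hh
  obtain ⟨f, hf⟩ := exists_redMat_limit I (fun l => apx p e c b (h * l)) B hB (by
    intro N l hNl
    rw [mul_add, mul_one]
    exact apx_step he I hb hcb N _ _ (hNl.trans (hl l)))
  obtain ⟨f', hf'⟩ := exists_redMat_limit I (fun l => apx p e b c (h * l)) B hB' (by
    intro N l hNl
    rw [mul_add, mul_one]
    exact apx_step he I hc hcb.symm N _ _ (hNl.trans (hl l)))
  have h1 : f * f' = 1 := by
    refine eq_of_redMat I _ _ fun N => ?_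
    rw [map_mul, hf, hf', ← map_mul, apx_mul_apx hc hb]
  refine ⟨f, IsUnit.of_mul_eq_one f' h1, ?_⟩
  refine eq_of_redMat I _ _ fun N => ?_
  rw [map_mul, hf, map_mul, redMat_frob _ _ _ (hf N), ← map_mul (redMat (I ^ N) r) c,
    ← apx_frob hb, map_mul, apx_step he I hb hcb N _ 1 (hl N)]

end Limit

/-! ### Bounded poles -/

lemma InZPow.mul' {A : Type*} [CommRing A] {a b : ℤ} {x y : LaurentSeries A} (hx : InZPow a x)
    (hy : InZPow b y) : InZPow (a + b) (x * y) := by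
  intro n hn
  rw [HahnSeries.coeff_mul]
  refine Finset.sum_eq_zero fun ij hij => ?_
  rw [Finset.mem_addAntidiagonal] at hij
  by_cases h : ij.1 < a
  · rw [hx _ h, zero_mul]
  · rw [hy _ (by omega), mul_zero]

lemma InZPow.mono' {A : Type*} [CommRing A] {a b : ℤ} {x : LaurentSeries A} (hx : InZPow a x)
    (hab : b ≤ a) : InZPow b x := fun n hn => hx n (by omega)

lemma exists_bound_matrix {A : Type*} [CommRing A] {r : ℕ}
    (M : Matrix (Fin r) (Fin r) (LaurentSeries A)) : ∃ B : ℤ, ∀ i j, InZPow B (M i j) := by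
  obtain ⟨B, hB⟩ := (Set.finite_range fun ij : Fin r × Fin r => (M ij.1 ij.2).order).bddBelow
  refine ⟨B, fun i j n hn => HahnSeries.coeff_eq_zero_of_lt_order (hn.trans_le ?_)⟩
  exact hB ⟨(i, j), rfl⟩

lemma InZPow.matrix_mul {A : Type*} [CommRing A] {r : ℕ} {a b : ℤ}
    {M N : Matrix (Fin r) (Fin r) (LaurentSeries A)} (hM : ∀ i j, InZPow a (M i j))
    (hN : ∀ i j, InZPow b (N i j)) (i j : Fin r) : InZPow (a + b) ((M * N) i j) := by
  intro n hn
  rw [Matrix.mul_apply, HahnSeries.coeff_sum]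
  exact Finset.sum_eq_zero fun k _ => (hM i k).mul' (hN k j) n hn

lemma InZPow.iter {A : Type*} [CommRing A] {p e : ℕ} [Fact p.Prime] [ExpChar A p] {r : ℕ} {a : ℤ}
    {M : Matrix (Fin r) (Fin r) (LaurentSeries A)} (hM : ∀ i j, InZPow a (M i j)) (k : ℕ)
    (i j : Fin r) : InZPow a (((msg p e A r)^[k] M) i j) := by
  intro n hn
  rw [msg_iter_apply, sg_iter_coeff, hM i j n hn, zero_pow]
  exact pow_ne_zero _ (pow_ne_zero _ (Fact.out : p.Prime).ne_zero)

lemma nm_mul_z {A : Type*} [CommRing A] {p e : ℕ} [ExpChar A p] {r : ℕ}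
    {c : Matrix (Fin r) (Fin r) (LaurentSeries A)} {h : ℕ} {m : ℤ}
    (hc : nm (msg p e A r) c h = (zPow m : LaurentSeries A) • 1) (l : ℕ) :
    nm (msg p e A r) c (h * l) = (zPow (m * l) : LaurentSeries A) • 1 := by
  have htz : ((sg p e A) ^ h) (zPow m) = zPow m := by
    rw [RingHom.coe_pow]
    clear hc
    induction h with
    | zero => rfl
    | succ h ih => rw [Function.iterate_succ_apply', ih, sg_zPow]
  rw [nm_mul (msg p e A r) _ h ((sg p e A) ^ h).mapMatrix (mapMatrix_iter (sg p e A) h), hc,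
      nm_smul _ _ htz, nm_one, zPow_pow]

lemma zPow_smul_isUnit {A : Type*} [CommRing A] {r : ℕ} (m : ℤ) :
    IsUnit ((zPow m : LaurentSeries A) • (1 : Matrix (Fin r) (Fin r) (LaurentSeries A))) := by
  refine IsUnit.of_mul_eq_one ((zPow (-m) : LaurentSeries A) • 1) ?_
  rw [Matrix.smul_mul, one_mul, smul_smul, ← zPow_add, add_neg_cancel, zPow_zero, one_smul]

lemma bounded_at_point {R K : Type*} [CommRing R] [CommRing K] {p e r : ℕ} [Fact p.Prime]
    [ExpChar R p] [ExpChar K p] (φ : R →+* K)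
    {c b : Matrix (Fin r) (Fin r) (LaurentSeries R)} (hc : IsUnit c) (hb : IsUnit b)
    {h : ℕ} {m : ℤ} (hcz : nm (msg p e R r) c h = (zPow m : LaurentSeries R) • 1)
    (y y' : Matrix (Fin r) (Fin r) (LaurentSeries K)) (hy : y' * y = 1)
    (hbz : nm (msg p e K r) (y' * (lmapHom φ).mapMatrix b * msg p e K r y) h =
      (zPow m : LaurentSeries K) • 1) :
    ∃ B : ℤ, ∀ l i j, InZPow B (lmapHom φ (apx p e c b (h * l) i j)) ∧
      InZPow B (lmapHom φ (apx p e b c (h * l) i j)) := by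
  have hy' : y * y' = 1 := mul_eq_one_comm.1 hy
  obtain ⟨B₁, hB₁⟩ := exists_bound_matrix y
  obtain ⟨B₂, hB₂⟩ := exists_bound_matrix y'
  set Φ : Matrix (Fin r) (Fin r) (LaurentSeries R) →+* Matrix (Fin r) (Fin r) (LaurentSeries K) :=
    (lmapHom φ).mapMatrix with hΦ
  have hΦs : ∀ x, Φ (msg p e R r x) = msg p e K r (Φ x) := fun x =>
    Matrix.ext fun i j => sg_lmap p e φ (x i j)
  have hi1 : ∀ k, (msg p e K r)^[k] y * (msg p e K r)^[k] y' = 1 := fun k => by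
    rw [← iterate_map_mul, hy', iterate_map_one]
  have hi2 : ∀ k, (msg p e K r)^[k] y' * (msg p e K r)^[k] y = 1 := fun k => by
    rw [← iterate_map_mul, hy, iterate_map_one]
  have hcl : ∀ l : ℕ, Φ (nm (msg p e R r) c (h * l)) = (zPow (m * l) : LaurentSeries K) • 1 := by
    intro l
    rw [nm_mul_z hcz]
    refine Matrix.ext fun i j => ?_
    rw [hΦ, RingHom.mapMatrix_apply, Matrix.map_apply, Matrix.smul_apply, Matrix.smul_apply,
      smul_eq_mul, smul_eq_mul, map_mul, lmapHom_zPow]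
    congr 1
    rw [Matrix.one_apply, Matrix.one_apply]
    split_ifs <;> simp
  have hbl : ∀ l : ℕ, Φ (nm (msg p e R r) b (h * l)) =
      (zPow (m * l) : LaurentSeries K) • (y * (msg p e K r)^[h * l] y') := by
    intro l
    have h1 := nm_mul_z hbz l
    rw [nm_conj _ hy hy', ← nm_map _ _ Φ hΦs] at h1
    calc Φ (nm (msg p e R r) b (h * l)) = (y * y') * Φ (nm (msg p e R r) b (h * l)) *
          ((msg p e K r)^[h * l] y * (msg p e K r)^[h * l] y') := by
          rw [hy', hi1, one_mul, mul_one]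
      _ = y * (y' * Φ (nm (msg p e R r) b (h * l)) * (msg p e K r)^[h * l] y) *
          (msg p e K r)^[h * l] y' := by simp only [mul_assoc]
      _ = _ := by
          rw [h1, Matrix.mul_smul, mul_one, Matrix.smul_mul]
  have e1 : ∀ l, Φ (apx p e c b (h * l)) = (msg p e K r)^[h * l] y * y' := by
    intro l
    refine ((isUnit_nm (msg p e R r) hb (h * l)).map Φ).mul_right_cancel ?_
    rw [← map_mul, apx_mul _ hb, hcl, hbl, Matrix.mul_smul]
    congr 1
    calc (1 : Matrix (Fin r) (Fin r) (LaurentSeries K)) =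
        (msg p e K r)^[h * l] y * (msg p e K r)^[h * l] y' := (hi1 _).symm
      _ = (msg p e K r)^[h * l] y * (y' * y) * (msg p e K r)^[h * l] y' := by rw [hy, mul_one]
      _ = _ := by simp only [mul_assoc]
  have e2 : ∀ l, Φ (apx p e b c (h * l)) = y * (msg p e K r)^[h * l] y' := by
    intro l
    refine ((isUnit_nm (msg p e R r) hc (h * l)).map Φ).mul_right_cancel ?_
    rw [← map_mul, apx_mul _ hc, hcl, hbl, Matrix.mul_smul, mul_one]
  refine ⟨B₁ + B₂, fun l i j => ⟨?_, ?_⟩⟩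
  · have := InZPow.matrix_mul (InZPow.iter (p := p) (e := e) hB₁ (h * l)) hB₂ i j
    rw [← e1] at this
    exact this
  · have := InZPow.matrix_mul hB₁ (InZPow.iter (p := p) (e := e) hB₂ (h * l)) i j
    rw [← e2] at this
    exact this

lemma family_core {R : Type*} [CommRing R] {p e r : ℕ} [Fact p.Prime] [ExpChar R p] (he : 1 ≤ e)
    (I : Ideal R) [IsAdicComplete I R] {ι : Type*} [Finite ι] (K : ι → Type*)
    [∀ i, CommRing (K i)] [∀ i, ExpChar (K i) p] (φ : ∀ i, R →+* K i)
    (hφ : ∀ a, (∀ i, φ i a = 0) → a = 0)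
    {c b : Matrix (Fin r) (Fin r) (LaurentSeries R)} (hc : IsUnit c) (hb : IsUnit b)
    (hcb : redMat I r b = redMat I r c) (h : ℕ) (hh : 1 ≤ h) (m : ℤ)
    (hcz : nm (msg p e R r) c h = (zPow m : LaurentSeries R) • 1)
    (hN : ∀ i, ∃ y y' : Matrix (Fin r) (Fin r) (LaurentSeries (K i)), y' * y = 1 ∧
      nm (msg p e (K i) r) (y' * (lmapHom (φ i)).mapMatrix b * msg p e (K i) r y) h =
        (zPow m : LaurentSeries (K i)) • 1) :
    ∃ f : Matrix (Fin r) (Fin r) (LaurentSeries R), IsUnit f ∧ f * b = c * msg p e R r f := by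
  choose y y' hy hyz using hN
  choose B hB using fun i => bounded_at_point (φ i) hc hb hcz (y i) (y' i) (hy i) (hyz i)
  obtain ⟨B₀, hB₀⟩ := (Set.finite_range B).bddBelow
  have hle : ∀ i, B₀ ≤ B i := fun i => hB₀ ⟨i, rfl⟩
  refine limit_core he I hc hb hcb h hh B₀ (fun l i j n hn => hφ _ fun k => ?_)
    (fun l i j n hn => hφ _ fun k => ?_)
  · exact (hB k l i j).1 n (hn.trans_le (hle k))
  · exact (hB k l i j).2 n (hn.trans_le (hle k))
/-! ### The main theorem -/

lemma monoMat_map {A B : Type*} [CommRing A] [CommRing B] (f : A →+* B) {r : ℕ}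
    (π : Fin r → Fin r) (d : Fin r → ℤ) :
    (lmapHom f).mapMatrix (monoMat zPow π d) = monoMat zPow π d := by
  refine Matrix.ext fun i j => ?_
  change lmapHom f (if i = π j then zPow (d j) else 0) = if i = π j then zPow (d j) else 0
  split_ifs
  · exact lmapHom_zPow _ _
  · exact map_zero _

lemma zPow_smul_map {A B : Type*} [CommRing A] [CommRing B] (f : A →+* B) {r : ℕ} (m : ℤ) :
    (lmapHom f).mapMatrix ((zPow m : LaurentSeries A) • (1 : Matrix (Fin r) (Fin r) _)) =
      (zPow m : LaurentSeries B) • 1 := by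
  refine Matrix.ext fun i j => ?_
  rw [RingHom.mapMatrix_apply, Matrix.map_apply, Matrix.smul_apply, Matrix.smul_apply,
    smul_eq_mul, smul_eq_mul, map_mul, lmapHom_zPow]
  congr 1
  rw [Matrix.one_apply, Matrix.one_apply]
  split_ifs <;> simp

lemma msg_lmap {A B : Type*} [CommRing A] [CommRing B] {p e r : ℕ} [ExpChar A p] [ExpChar B p]
    (f : A →+* B) (x : Matrix (Fin r) (Fin r) (LaurentSeries A)) :
    (lmapHom f).mapMatrix (msg p e A r x) = msg p e B r ((lmapHom f).mapMatrix x) :=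
  Matrix.ext fun i j => sg_lmap p e f (x i j)

lemma lmapHom_mapMatrix_injective {A B : Type*} [CommRing A] [CommRing B] (f : A →+* B)
    (hf : Function.Injective f) {r : ℕ} :
    Function.Injective ((lmapHom f).mapMatrix : Matrix (Fin r) (Fin r) (LaurentSeries A) →+* _) := by
  intro x y hxy
  refine Matrix.ext fun i j => ?_
  ext n
  exact hf (congrArg (fun s => HahnSeries.coeff s n) (congrFun (congrFun hxy i) j))

lemma isUnit_of_nm {S : Type*} [Ring S] [IsDedekindFiniteMonoid S] (s : S →+* S) (c : S) (h : ℕ)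
    (hh : 1 ≤ h) (hc : IsUnit (nm s c h)) : IsUnit c := by
  obtain ⟨k, rfl⟩ : ∃ k, h = k + 1 := ⟨h - 1, by omega⟩
  rw [nm_succ'] at hc
  exact isUnit_of_mul_isUnit_left hc

lemma ptHom_eq_zero {R : Type*} [CommRing R] (𝔭 : PrimeSpectrum R) (a : R) :
    ptHom 𝔭 a = 0 ↔ a ∈ 𝔭.asIdeal := by
  rw [ptHom, RingHom.comp_apply, RingHom.comp_apply, map_eq_zero_iff _ (RingHom.injective _),
    map_eq_zero_iff _ (IsFractionRing.injective _ _), Ideal.Quotient.eq_zero_iff_mem]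

lemma algClosure_surjective (F : Type*) [Field F] [IsAlgClosed F] :
    Function.Surjective (((algebraMap (FractionRing F) (AlgebraicClosure (FractionRing F))).comp
      (algebraMap F (FractionRing F)) : F →+* AlgebraicClosure (FractionRing F))) := by
  have h1 : Function.Bijective (algebraMap F (FractionRing F)) :=
    IsField.localization_map_bijective (M := nonZeroDivisors F) (by simp) (Field.toIsField F)
  have h2 : IsAlgClosed (FractionRing F) :=
    IsAlgClosed.of_ringEquiv F (FractionRing F) (RingEquiv.ofBijective _ h1)
  have h3 := IsAlgClosed.algebraMap_bijective_of_isIntegral (k := FractionRing F)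
    (K := AlgebraicClosure (FractionRing F))
  exact h3.2.comp h1.2

lemma ptHom_closed_surjective {R : Type*} [CommRing R] [IsLocalRing R]
    [hA : IsAlgClosed (IsLocalRing.ResidueField R)] :
    Function.Surjective (ptHom (IsLocalRing.closedPoint R)) := by
  have h := @algClosure_surjective (IsLocalRing.ResidueField R) _ hA
  exact h.comp Ideal.Quotient.mk_surjective

lemma newton_change {R K : Type*} [CommRing R] [CommRing K] {p e r : ℕ} [ExpChar R p]
    [ExpChar K p] (φ : R →+* K) (b : Matrix (Fin r) (Fin r) (LaurentSeries R))
    {G G' : Matrix (Fin r) (Fin r) (LaurentSeries R)} (hG : G * G' = 1)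
    (y : Matrix (Fin r) (Fin r) (LaurentSeries K)) (hy : IsUnit y) {h : ℕ}
    {w : Matrix (Fin r) (Fin r) (LaurentSeries K)}
    (hyz : nm (msg p e K r) (y⁻¹ * (lmapHom φ).mapMatrix b * msg p e K r y) h = w) :
    ∃ x x' : Matrix (Fin r) (Fin r) (LaurentSeries K), x' * x = 1 ∧
      nm (msg p e K r) (x' * (lmapHom φ).mapMatrix (G' * b * msg p e R r G) * msg p e K r x) h =
        w := by
  have hyd := (Matrix.isUnit_iff_isUnit_det y).1 hy
  have k1 : (lmapHom φ).mapMatrix G * (lmapHom φ).mapMatrix G' = 1 := by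
    rw [← map_mul, hG, map_one]
  have k2 : msg p e K r ((lmapHom φ).mapMatrix G) * msg p e K r ((lmapHom φ).mapMatrix G') = 1 := by
    rw [← map_mul, k1, map_one]
  refine ⟨(lmapHom φ).mapMatrix G' * y, y⁻¹ * (lmapHom φ).mapMatrix G, ?_, ?_⟩
  · rw [mul_assoc, ← mul_assoc ((lmapHom φ).mapMatrix G), k1, one_mul,
      Matrix.nonsing_inv_mul y hyd]
  · rw [← hyz, map_mul, map_mul, map_mul (msg p e K r), msg_lmap]
    generalize (lmapHom φ).mapMatrix G = g at *
    generalize (lmapHom φ).mapMatrix G' = g' at *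
    generalize (lmapHom φ).mapMatrix b = c at *
    congr 1
    calc y⁻¹ * g * (g' * c * msg p e K r g) * (msg p e K r g' * msg p e K r y)
        = y⁻¹ * (g * g') * c * (msg p e K r g * msg p e K r g') * msg p e K r y := by
          simp only [mul_assoc]
      _ = _ := by rw [k1, k2, mul_one, mul_one]

theorem basic_isogenous_to_constant
    {p : ℕ} [Fact p.Prime] {e : ℕ} (he : 1 ≤ e) {q : ℕ} (hq : q = p ^ e)
    {R : Type*} [CommRing R] [Algebra (GaloisField p e) R]
    [IsReduced R] [IsNoetherianRing R] [IsLocalRing R]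
    [IsAdicComplete (IsLocalRing.maximalIdeal R) R]
    [IsAlgClosed (IsLocalRing.ResidueField R)]
    {r : ℕ} (hr : 1 ≤ r)
    (b : Matrix (Fin r) (Fin r) (LaurentSeries R)) (hb : IsUnit b)
    (h : ℕ) (hh : 1 ≤ h) (m : ℤ)
    (hNewton : ∀ 𝔭 : PrimeSpectrum R,
      ∃ y : Matrix (Fin r) (Fin r)
          (LaurentSeries (AlgebraicClosure (FractionRing (R ⧸ 𝔭.asIdeal)))),
        IsUnit y ∧
        sigmaPowProd q h (y⁻¹ * b.map (lmap (ptHom 𝔭)) * matFrob q y) =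
          (zPow m : LaurentSeries (AlgebraicClosure (FractionRing (R ⧸ 𝔭.asIdeal)))) •
            (1 : Matrix (Fin r) (Fin r)
              (LaurentSeries (AlgebraicClosure (FractionRing (R ⧸ 𝔭.asIdeal)))))) :
    ∃ (bF : Matrix (Fin r) (Fin r) (LaurentSeries (GaloisField p e)))
      (f : Matrix (Fin r) (Fin r) (LaurentSeries R)),
      IsUnit bF ∧ IsUnit f ∧
      f * b = bF.map (lmap (algebraMap (GaloisField p e) R)) * matFrob q f := by
  subst hq
  have hcR : CharP R p := charP_of_injective_algebraMap (algebraMap (GaloisField p e) R).injective p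
  have hcK : ∀ 𝔭 : PrimeSpectrum R,
      CharP (AlgebraicClosure (FractionRing (R ⧸ 𝔭.asIdeal))) p := fun 𝔭 =>
    charP_of_injective_ringHom ((ptHom 𝔭).comp (algebraMap (GaloisField p e) R)).injective p
  have hxR : ExpChar R p := .prime Fact.out
  have hxF : ExpChar (GaloisField p e) p := .prime Fact.out
  have hxK : ∀ 𝔭 : PrimeSpectrum R,
      ExpChar (AlgebraicClosure (FractionRing (R ⧸ 𝔭.asIdeal))) p := fun 𝔭 => .prime Fact.out
  have hN : ∀ 𝔭 : PrimeSpectrum R, ∃ y : Matrix (Fin r) (Fin r)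
          (LaurentSeries (AlgebraicClosure (FractionRing (R ⧸ 𝔭.asIdeal)))), IsUnit y ∧
        nm (msg p e _ r) (y⁻¹ * (lmapHom (ptHom 𝔭)).mapMatrix b * msg p e _ r y) h =
          (zPow m : LaurentSeries (AlgebraicClosure (FractionRing (R ⧸ 𝔭.asIdeal)))) • 1 := by
    intro 𝔭
    obtain ⟨y, hy, hyz⟩ := hNewton 𝔭
    refine ⟨y, hy, ?_⟩
    rw [sigmaPowProd_eq, matFrob_eq] at hyz
    exact hyz
  clear hNewton
  -- the closed point
  obtain ⟨g, π, d, hg, hgb, hgz⟩ : ∃ (g : Matrix (Fin r) (Fin r) (LaurentSeries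
      (AlgebraicClosure (FractionRing (R ⧸ (IsLocalRing.closedPoint R).asIdeal)))))
      (π : Fin r → Fin r) (d : Fin r → ℤ), IsUnit g ∧
      (lmapHom (ptHom (IsLocalRing.closedPoint R))).mapMatrix b * msg p e _ r g =
        g * monoMat zPow π d ∧
      nm (msg p e _ r) (monoMat zPow π d) h = (zPow m : LaurentSeries
        (AlgebraicClosure (FractionRing (R ⧸ (IsLocalRing.closedPoint R).asIdeal)))) • 1 := by
    obtain ⟨y, hy, hyz⟩ := hN (IsLocalRing.closedPoint R)
    obtain ⟨x, π, d, hx, hxc, hz⟩ := closed_point he _ h hh m hyz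
    refine ⟨y * x, π, d, hy.mul hx, ?_, hz⟩
    rw [mul_assoc y, ← hxc, map_mul]
    simp only [← mul_assoc]
    rw [Matrix.mul_nonsing_inv y ((Matrix.isUnit_iff_isUnit_det y).1 hy), one_mul]
  -- the constant model
  have hFz : nm (msg p e (GaloisField p e) r) (monoMat zPow π d) h =
      (zPow m : LaurentSeries (GaloisField p e)) • 1 := by
    apply lmapHom_mapMatrix_injective ((ptHom (IsLocalRing.closedPoint R)).comp
      (algebraMap (GaloisField p e) R)) (RingHom.injective _)
    rw [nm_map _ _ _ (msg_lmap (p := p) (e := e) (r := r) _), monoMat_map, hgz, zPow_smul_map]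
  have hRz : nm (msg p e R r) (monoMat zPow π d) h = (zPow m : LaurentSeries R) • 1 := by
    have := congrArg (lmapHom (algebraMap (GaloisField p e) R)).mapMatrix hFz
    rwa [nm_map _ _ _ (msg_lmap (p := p) (e := e) (r := r) _), monoMat_map, zPow_smul_map] at this
  have hFu : IsUnit (monoMat zPow π d : Matrix _ _ (LaurentSeries (GaloisField p e))) :=
    isUnit_of_nm _ _ h hh (hFz ▸ zPow_smul_isUnit m)
  have hRu : IsUnit (monoMat zPow π d : Matrix _ _ (LaurentSeries R)) :=
    isUnit_of_nm _ _ h hh (hRz ▸ zPow_smul_isUnit m)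
  -- lift of the trivialization
  obtain ⟨G, hG, hGg⟩ := lift_matrix (ptHom (IsLocalRing.closedPoint R)) ptHom_closed_surjective
    (by
      intro a ha
      by_contra hna
      exact ha ((ptHom_eq_zero _ a).2 hna)) g hg
  have hGd := (Matrix.isUnit_iff_isUnit_det G).1 hG
  have hG1 : G⁻¹ * G = 1 := Matrix.nonsing_inv_mul G hGd
  have hG2 : G * G⁻¹ = 1 := Matrix.mul_nonsing_inv G hGd
  have hGi : IsUnit G⁻¹ := IsUnit.of_mul_eq_one G hG1
  set b' := G⁻¹ * b * msg p e R r G with hb'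
  have hb'u : IsUnit b' := (hGi.mul hb).mul (hG.map _)
  have hcong : redMat (IsLocalRing.maximalIdeal R) r b' =
      redMat (IsLocalRing.maximalIdeal R) r (monoMat zPow π d) := by
    have h1 : (lmapHom (ptHom (IsLocalRing.closedPoint R))).mapMatrix b' =
        (lmapHom (ptHom (IsLocalRing.closedPoint R))).mapMatrix (monoMat zPow π d) := by
      refine hg.mul_left_cancel ?_
      rw [monoMat_map, ← hgb, ← hGg, ← msg_lmap, ← map_mul, ← map_mul, hb', ← mul_assoc,
        ← mul_assoc, hG2, one_mul]
    rw [redMat_eq_iff]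
    intro i j n
    refine (ptHom_eq_zero (IsLocalRing.closedPoint R) _).1 ?_
    rw [map_sub, sub_eq_zero]
    exact congrArg (fun s => HahnSeries.coeff s n) (congrFun (congrFun h1 i) j)
  have hfin : Finite (minimalPrimes R) := (minimalPrimes.finite_of_isNoetherianRing R).to_subtype
  obtain ⟨pp, hpp⟩ : ∃ pp : minimalPrimes R → PrimeSpectrum R, ∀ P, (pp P).asIdeal = P.1 :=
    ⟨fun P => ⟨P.1, P.2.1.1⟩, fun _ => rfl⟩
  obtain ⟨f, hf, hfb⟩ := family_core (p := p) (e := e) he (IsLocalRing.maximalIdeal R)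
    (ι := minimalPrimes R)
    (fun P => AlgebraicClosure (FractionRing (R ⧸ (pp P).asIdeal)))
    (fun P => ptHom (pp P)) (by
      intro a ha
      have h1 : a ∈ sInf (minimalPrimes R) := by
        rw [Ideal.mem_sInf]
        intro P hP
        have h3 := (ptHom_eq_zero _ a).1 (ha ⟨P, hP⟩)
        rwa [hpp] at h3
      rw [minimalPrimes, Ideal.sInf_minimalPrimes] at h1
      have h2 : IsNilpotent a := h1
      exact h2.eq_zero) hRu hb'u hcong h hh m hRz (by
      intro P
      obtain ⟨y, hy, hyz⟩ := hN (pp P)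
      exact newton_change (ptHom (pp P)) b hG2 y hy hyz)
  refine ⟨monoMat zPow π d, f * G⁻¹, hFu, hf.mul hGi, ?_⟩
  have hmap : (monoMat zPow π d : Matrix _ _ (LaurentSeries (GaloisField p e))).map
      (lmap (algebraMap (GaloisField p e) R)) = monoMat zPow π d := monoMat_map _ π d
  rw [hmap, matFrob_eq, map_mul, ← mul_assoc, ← hfb, hb']
  have k3 : msg p e R r G * msg p e R r G⁻¹ = 1 := by rw [← map_mul, hG2, map_one]
  simp only [mul_assoc]
  rw [k3, mul_one]

end HVpaper
end
end

section
/- Let A be a commutative ring and let u be a unit of the Laurent series ring A((z)) = A⟦z⟧[1/z]. For every prime ideal 𝔭 of A, the image u(𝔭) of u in κ(𝔭)((z)) (the Laurent series field over the residue field κ(𝔭)) is nonzero; let ord_𝔭(u) ∈ ℤ denote its z-adic order, i.e. the least n such that the n-th coefficient of u is nonzero in κ(𝔭). Then the function 𝔭 ↦ ord_𝔭(u) is locally constant on Spec A with the Zariski topology. -/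
noncomputable section

open scoped Classical

namespace HVpaper

variable {A : Type*} [CommRing A]

variable {k : Type*} [Field k]

/-- For a prime `𝔭` of `A`, the canonical homomorphism from `A` to the residue field
`κ(𝔭) = Frac(A/𝔭)`. -/
def resHom {R : Type*} [CommRing R] (𝔭 : PrimeSpectrum R) :
    R →+* FractionRing (R ⧸ 𝔭.asIdeal) :=
  (algebraMap (R ⧸ 𝔭.asIdeal) (FractionRing (R ⧸ 𝔭.asIdeal))).comp
    (Ideal.Quotient.mk 𝔭.asIdeal)

theorem lmap_mul_one {A B : Type*} [CommRing A] [CommRing B] (f : A →+* B)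
    {x y : LaurentSeries A} (h : x * y = 1) : lmap f x * lmap f y = 1 := by
  have h1 : lmap f (x * y) = lmap f x * lmap f y :=
    HahnSeries.map_mul (f : A →ₙ+* B)
  have h2 : lmap f (1 : LaurentSeries A) = 1 :=
    HahnSeries.map_one f.toMonoidWithZeroHom
  rw [← h1, h, h2]

theorem resHom_ne_zero_iff {R : Type*} [CommRing R] (𝔭 : PrimeSpectrum R) (a : R) :
    resHom 𝔭 a ≠ 0 ↔ a ∉ 𝔭.asIdeal := by
  unfold resHom
  rw [RingHom.comp_apply, Ne, IsFractionRing.to_map_eq_zero_iff, Ideal.Quotient.eq_zero_iff_mem]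

/-- **Proposition 2.7** for `G = GL_r`:  for a unit `u` of `A((z))`, the image of `u` in
`κ(𝔭)((z))` is nonzero for every prime `𝔭`, and its `z`-adic order is a locally constant
function on `Spec A` with the Zariski topology. -/
theorem order_locally_constant {R : Type*} [CommRing R] (u : (LaurentSeries R)ˣ) :
    (∀ 𝔭 : PrimeSpectrum R, lmap (resHom 𝔭) (u : LaurentSeries R) ≠ 0) ∧
    IsLocallyConstant fun 𝔭 : PrimeSpectrum R =>
      (lmap (resHom 𝔭) (u : LaurentSeries R)).order := by
  have hne : ∀ (w : (LaurentSeries R)ˣ) (𝔭 : PrimeSpectrum R),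
      lmap (resHom 𝔭) (w : LaurentSeries R) ≠ 0 := fun w 𝔭 =>
    left_ne_zero_of_mul_eq_one (lmap_mul_one (resHom 𝔭) w.mul_inv)
  have hsum : ∀ 𝔭 : PrimeSpectrum R, (lmap (resHom 𝔭) (u : LaurentSeries R)).order +
      (lmap (resHom 𝔭) ((u⁻¹ : (LaurentSeries R)ˣ) : LaurentSeries R)).order = 0 := by
    intro 𝔭
    rw [← HahnSeries.order_mul (hne u 𝔭) (hne u⁻¹ 𝔭), lmap_mul_one (resHom 𝔭) u.mul_inv,
      HahnSeries.order_one]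
  refine ⟨hne u, ?_⟩
  rw [IsLocallyConstant.iff_exists_open]
  intro 𝔭
  -- the leading coefficients of `u` and `u⁻¹` at `𝔭` stay invertible near `𝔭`
  have key : ∀ (w : (LaurentSeries R)ˣ), ∃ a : R, 𝔭 ∈ PrimeSpectrum.basicOpen a ∧
      ∀ 𝔮 ∈ PrimeSpectrum.basicOpen a, (lmap (resHom 𝔮) (w : LaurentSeries R)).order ≤
        (lmap (resHom 𝔭) (w : LaurentSeries R)).order := by
    intro w
    refine ⟨(w : LaurentSeries R).coeff (lmap (resHom 𝔭) (w : LaurentSeries R)).order, ?_, ?_⟩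
    · rw [PrimeSpectrum.mem_basicOpen, ← resHom_ne_zero_iff]
      exact HahnSeries.coeff_order_eq_zero.not.mpr (hne w 𝔭)
    · intro 𝔮 h𝔮
      rw [PrimeSpectrum.mem_basicOpen, ← resHom_ne_zero_iff] at h𝔮
      exact HahnSeries.order_le_of_coeff_ne_zero h𝔮
  obtain ⟨a, ha, ha'⟩ := key u
  obtain ⟨b, hb, hb'⟩ := key u⁻¹
  refine ⟨PrimeSpectrum.basicOpen a ∩ PrimeSpectrum.basicOpen b,
    (PrimeSpectrum.basicOpen a).isOpen.inter (PrimeSpectrum.basicOpen b).isOpen,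
    ⟨ha, hb⟩, ?_⟩
  rintro 𝔮 ⟨h1, h2⟩
  have e1 := ha' 𝔮 h1
  have e2 := hb' 𝔮 h2
  have e3 := hsum 𝔭
  have e4 := hsum 𝔮
  show HahnSeries.order _ = HahnSeries.order _
  linarith

end HVpaper
end
end
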